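/- Let ψ : ℝ⁺ → ℝ⁺ be a monotonic function with ψ(h) → 0 as h → ∞. Assume the Lebesgue divergence statement (Theorem BDKL): if Σ_{h=1}^∞ ψ(h) = ∞ then S₂(ψ) has full Lebesgue measure in [0,1)². Let f be a dimension function with r^{-2} f(r) monotonic such that g(r) := r^{-1} f(r) is a dimension function. If Σ_{h=1}^∞ g(ψ(h)/h²)·h² = ∞, then H^f(S₂(ψ)) = H^f([0,1)²). -/

import Mathlib

open MeasureTheory Set Filter
open scoped ENNReal

def IsDimFun (f : ℝ → ℝ) : Prop :=
  ContinuousOn f (Set.Ici 0) ∧ MonotoneOn f (Set.Ici 0) ∧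
    (∀ r, 0 ≤ r → 0 ≤ f r) ∧ Filter.Tendsto f (nhdsWithin 0 (Set.Ioi 0)) (nhds 0)

noncomputable def hMeasure {X : Type*} [EMetricSpace X] [MeasurableSpace X] [BorelSpace X]
    (f : ℝ → ℝ) : Measure X :=
  Measure.mkMetric (fun d => ENNReal.ofReal (f d.toReal))

/-- The set `S₂(ψ)` of `x ∈ [0,1)²` with `|a² · x - p²| < ψ(|a|)` for infinitely
many `(a, p) ∈ ℤ² × ℤ`. -/
def S2 (ψ : ℝ → ℝ) : Set (EuclideanSpace ℝ (Fin 2)) :=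
  {x | (∀ i, x i ∈ Set.Ico (0:ℝ) 1) ∧
    {q : (Fin 2 → ℤ) × ℤ |
      |(q.1 0 : ℝ) ^ 2 * x 0 + (q.1 1 : ℝ) ^ 2 * x 1 - (q.2 : ℝ) ^ 2| <
        ψ ((max (q.1 0).natAbs (q.1 1).natAbs : ℕ) : ℝ)}.Infinite}

/-- The unit box `[0,1)²`. -/
def box2 : Set (EuclideanSpace ℝ (Fin 2)) := {x | ∀ i, x i ∈ Set.Ico (0:ℝ) 1}

/-- Properties of the one-dimensional gauge. -/
structure Gauge (g : ℝ → ℝ) (r0 : ℝ) : Prop where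
  r0_pos : 0 < r0
  zero : g 0 = 0
  cont : ContinuousOn g (Set.Ici 0)
  mono : ∀ r s, 0 ≤ r → r ≤ s → g r ≤ g s
  anti : ∀ r s, 0 < r → r ≤ s → g s * r ≤ g r * s
  big : ∀ M : ℝ, ∃ δ > 0, ∀ r, 0 < r → r ≤ δ → M * r ≤ g r
  self : ∀ r, 0 < r → r ≤ r0 → r ≤ g r
  small : ∀ ε > 0, ∃ δ > 0, ∀ r, 0 ≤ r → r ≤ δ → g r ≤ ε

noncomputable def levelMeas {κ : Type*} (g : ℝ → ℝ) (μ : Measure ℝ) (F : Finset κ) (x r : κ → ℝ) :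
    Measure ℝ :=
  ∑ k ∈ F, (μ (Metric.closedBall (x k) (g (r k))) / ENNReal.ofReal (r k)) •
    volume.restrict (Metric.ball (x k) (r k / 2))

lemma levelMeas_apply {κ : Type*} (g : ℝ → ℝ) (μ : Measure ℝ) (F : Finset κ) (x r : κ → ℝ)
    (s : Set ℝ) (hs : MeasurableSet s) :
    levelMeas g μ F x r s = ∑ k ∈ F, (μ (Metric.closedBall (x k) (g (r k))) / ENNReal.ofReal (r k)) *
      volume (s ∩ Metric.ball (x k) (r k / 2)) := by
  simp only [levelMeas, Measure.coe_finsetSum, Finset.sum_apply, Measure.smul_apply, smul_eq_mul]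
  refine Finset.sum_congr rfl fun k _ => ?_
  rw [Measure.restrict_apply hs]

lemma term_le {m : ℝ≥0∞} {r y : ℝ} (hr : 0 < r) (s : Set ℝ) :
    m / ENNReal.ofReal r * volume (s ∩ Metric.ball y (r / 2)) ≤ m := by
  have h1 : volume (s ∩ Metric.ball y (r / 2)) ≤ ENNReal.ofReal r := by
    refine (measure_mono Set.inter_subset_right).trans ?_
    rw [Real.volume_ball]
    apply le_of_eq; congr 1; ring
  calc _ ≤ m / ENNReal.ofReal r * ENNReal.ofReal r := by gcongr
    _ = m := ENNReal.div_mul_cancel (by simpa using hr) ENNReal.ofReal_ne_top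

lemma levelMeas_le_of_hit {κ : Type*} (g : ℝ → ℝ) (μ : Measure ℝ) (F : Finset κ) (x r : κ → ℝ)
    (hr : ∀ k ∈ F, 0 < r k)
    (hd : (F : Set κ).PairwiseDisjoint (fun k => Metric.closedBall (x k) (g (r k))))
    (s W : Set ℝ) (hs : MeasurableSet s)
    (hW : ∀ k ∈ F, (s ∩ Metric.ball (x k) (r k / 2)).Nonempty →
      Metric.closedBall (x k) (g (r k)) ⊆ W) :
    levelMeas g μ F x r s ≤ μ W := by
  classical
  rw [levelMeas_apply _ _ _ _ _ _ hs]
  set F' := F.filter (fun k => (s ∩ Metric.ball (x k) (r k / 2)).Nonempty) with hF'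
  have h1 : ∀ k ∈ F, (μ (Metric.closedBall (x k) (g (r k))) / ENNReal.ofReal (r k)) *
      volume (s ∩ Metric.ball (x k) (r k / 2)) ≤
      if (s ∩ Metric.ball (x k) (r k / 2)).Nonempty then μ (Metric.closedBall (x k) (g (r k))) else 0 := by
    intro k hk
    split_ifs with h
    · exact term_le (hr k hk) s
    · rw [Set.not_nonempty_iff_eq_empty] at h
      simp [h]
  refine (Finset.sum_le_sum h1).trans ?_
  rw [← Finset.sum_filter]
  rw [← measure_biUnion_finset]
  · apply measure_mono
    apply Set.iUnion₂_subset
    intro k hk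
    rw [Finset.mem_filter] at hk
    exact hW k hk.1 hk.2
  · intro a ha b hb hab
    exact hd (Finset.mem_filter.1 ha).1 (Finset.mem_filter.1 hb).1 hab
  · intro k _
    exact measurableSet_closedBall

lemma levelMeas_univ {κ : Type*} (g : ℝ → ℝ) (μ : Measure ℝ) (F : Finset κ) (x r : κ → ℝ)
    (hr : ∀ k ∈ F, 0 < r k) :
    levelMeas g μ F x r Set.univ = ∑ k ∈ F, μ (Metric.closedBall (x k) (g (r k))) := by
  rw [levelMeas_apply _ _ _ _ _ _ MeasurableSet.univ]
  refine Finset.sum_congr rfl fun k hk => ?_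
  rw [Set.univ_inter, Real.volume_ball, show 2 * (r k / 2) = r k by ring]
  exact ENNReal.div_mul_cancel (by simpa using hr k hk) ENNReal.ofReal_ne_top

lemma levelMeas_density {κ : Type*} (g : ℝ → ℝ) (μ : Measure ℝ) [IsFiniteMeasure μ]
    (F : Finset κ) (x r : κ → ℝ)
    (hr : ∀ k ∈ F, 0 < r k) :
    ∃ M' : ℝ, 0 ≤ M' ∧ ∀ s, levelMeas g μ F x r s ≤ ENNReal.ofReal M' * volume s := by
  refine ⟨(∑ k ∈ F, (μ (Metric.closedBall (x k) (g (r k))) / ENNReal.ofReal (r k))).toReal,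
    ENNReal.toReal_nonneg, fun s => ?_⟩
  rw [ENNReal.ofReal_toReal]
  · simp only [levelMeas, Measure.coe_finsetSum, Finset.sum_apply, Measure.smul_apply, smul_eq_mul]
    rw [Finset.sum_mul]
    refine Finset.sum_le_sum fun k _ => ?_
    gcongr
    exact Measure.restrict_le_self
  · rw [ENNReal.sum_ne_top]
    intro k hk
    exact ENNReal.div_ne_top (measure_ne_top _ _) (by simpa using hr k hk)

lemma levelMeas_ball_le {κ : Type*} {g : ℝ → ℝ} {r0 : ℝ} (G : Gauge g r0) (μ : Measure ℝ)
    (F : Finset κ) (x r : κ → ℝ)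
    (hr : ∀ k ∈ F, 0 < r k) (hr' : ∀ k ∈ F, r k ≤ r0)
    (hd : (F : Set κ).PairwiseDisjoint (fun k => Metric.closedBall (x k) (g (r k))))
    (M : ℝ) (hM : 0 ≤ M) (hμ : ∀ s, μ s ≤ ENNReal.ofReal M * volume s)
    (y ρ : ℝ) (hρ : 0 < ρ) (hρ0 : ρ ≤ r0) :
    levelMeas g μ F x r (Metric.closedBall y ρ) ≤ ENNReal.ofReal (20 * M * g ρ) := by
  classical
  have hgρ := G.self ρ hρ hρ0
  by_cases h2 : ∃ k ∈ F, ∃ k' ∈ F, k ≠ k' ∧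
      (Metric.closedBall y ρ ∩ Metric.ball (x k) (r k / 2)).Nonempty ∧
      (Metric.closedBall y ρ ∩ Metric.ball (x k') (r k' / 2)).Nonempty
  · have key : ∀ k ∈ F, ∀ k' ∈ F, k ≠ k' →
      (Metric.closedBall y ρ ∩ Metric.ball (x k) (r k / 2)).Nonempty →
      (Metric.closedBall y ρ ∩ Metric.ball (x k') (r k' / 2)).Nonempty → g (r k) ≤ 4 * ρ := by
      rintro k hk k' hk' hne ⟨p, hp1, hp2⟩ ⟨p', hp1', hp2'⟩
      have hdis := hd hk hk' hne
      have gk := G.self _ (hr k hk) (hr' k hk)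
      have gk' := G.self _ (hr k' hk') (hr' k' hk')
      have rk := hr k hk
      have rk' := hr k' hk'
      simp only [Function.onFun] at hdis
      rw [disjoint_closedBall_closedBall_iff (by linarith) (by linarith)] at hdis
      rw [Metric.mem_closedBall] at hp1 hp1'
      rw [Metric.mem_ball] at hp2 hp2'
      have t1 : dist (x k) (x k') ≤ dist (x k) p + dist p (x k') := dist_triangle _ _ _
      have t2 : dist p (x k') ≤ dist p y + dist y (x k') := dist_triangle _ _ _
      have t3 : dist y (x k') ≤ dist y p' + dist p' (x k') := dist_triangle _ _ _
      rw [dist_comm (x k) p] at t1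
      rw [dist_comm y p'] at t3
      linarith
    have hle : levelMeas g μ F x r (Metric.closedBall y ρ) ≤ μ (Metric.closedBall y (9 * ρ)) := by
      apply levelMeas_le_of_hit g μ F x r hr hd _ _ measurableSet_closedBall
      intro k hk hkn
      have hg4 : g (r k) ≤ 4 * ρ := by
        obtain ⟨k1, hk1, k2, hk2, hne, n1, n2⟩ := h2
        by_cases hkk : k = k1
        · subst hkk; exact key _ hk _ hk2 hne hkn n2
        · exact key _ hk _ hk1 hkk hkn n1
      obtain ⟨p, hp1, hp2⟩ := hkn
      have gk := G.self _ (hr k hk) (hr' k hk)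
      have rk := hr k hk
      apply Metric.closedBall_subset_closedBall'
      rw [Metric.mem_closedBall] at hp1
      rw [Metric.mem_ball] at hp2
      have t1 : dist (x k) y ≤ dist (x k) p + dist p y := dist_triangle _ _ _
      rw [dist_comm (x k) p] at t1
      linarith
    refine hle.trans ((hμ _).trans ?_)
    rw [Real.volume_closedBall, ← ENNReal.ofReal_mul hM]
    apply ENNReal.ofReal_le_ofReal
    nlinarith
  · push Not at h2
    rw [levelMeas_apply _ _ _ _ _ _ measurableSet_closedBall]
    by_cases h1 : ∃ k ∈ F, (Metric.closedBall y ρ ∩ Metric.ball (x k) (r k / 2)).Nonempty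
    · obtain ⟨k, hk, hkn⟩ := h1
      rw [Finset.sum_eq_single_of_mem k hk]
      · have rk := hr k hk
        have gk := G.self _ (hr k hk) (hr' k hk)
        have hD : μ (Metric.closedBall (x k) (g (r k))) ≤ ENNReal.ofReal (2 * M * g (r k)) := by
          refine (hμ _).trans ?_
          rw [Real.volume_closedBall, ← ENNReal.ofReal_mul hM]
          apply ENNReal.ofReal_le_ofReal
          linarith
        rcases le_total (r k) ρ with hle | hle
        · refine (term_le rk _).trans (hD.trans ?_)
          apply ENNReal.ofReal_le_ofReal
          have := G.mono _ _ rk.le hle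
          nlinarith
        · calc _ ≤ ENNReal.ofReal (2 * M * g (r k)) / ENNReal.ofReal (r k) * ENNReal.ofReal (2 * ρ) := by
                gcongr
                rw [← Real.volume_closedBall y]
                exact measure_mono Set.inter_subset_left
            _ = ENNReal.ofReal (2 * M * g (r k) / r k * (2 * ρ)) := by
                rw [← ENNReal.ofReal_div_of_pos rk, ← ENNReal.ofReal_mul]
                have : 0 ≤ g (r k) := by linarith
                positivity
            _ ≤ _ := by
                apply ENNReal.ofReal_le_ofReal
                have h3 := G.anti ρ (r k) hρ hle
                have h4 : g (r k) * ρ / r k ≤ g ρ := by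
                  rw [div_le_iff₀ rk]; exact h3
                have h5 : 2 * M * g (r k) / r k * (2 * ρ) = 4 * M * (g (r k) * ρ / r k) := by ring
                rw [h5]
                have : 0 ≤ g ρ := by linarith
                nlinarith [mul_le_mul_of_nonneg_left h4 hM, mul_nonneg hM this]
      · intro k' hk' hne
        have := h2 k hk k' hk' hne.symm hkn
        simp [this]
    · push Not at h1
      rw [Finset.sum_eq_zero]
      · exact zero_le
      · intro k hk
        have := h1 k hk
        simp [this]

structure Sys {ι : Type*} (g : ℝ → ℝ) (x r : ι → ℝ) (h : ι → ℕ) (I : Set ℝ) : Prop where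
  r_nonneg : ∀ q, 0 ≤ r q
  r_small : ∀ ε > 0, ∃ N, ∀ q, N ≤ h q → r q ≤ ε
  full : ∀ n, ∀ᵐ t : ℝ, t ∈ I → ∃ q, n ≤ h q ∧ |t - x q| < g (r q)

def tailSet {ι : Type*} (x r : ι → ℝ) (h : ι → ℕ) (n : ℕ) : Set ℝ :=
  {t | ∃ q, n ≤ h q ∧ |t - x q| < r q}

lemma level_exists {ι : Type*} {g : ℝ → ℝ} {r0 : ℝ} (G : Gauge g r0) {x r : ι → ℝ} {h : ι → ℕ}
    {I : Set ℝ} (S : Sys g x r h I) (U : Set ℝ) (hU : IsOpen U) (hUI : U ⊆ I)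
    (μ : Measure ℝ) [IsFiniteMeasure μ] (hμU : μ Uᶜ = 0)
    (M : ℝ) (hM : 0 ≤ M) (hμ : ∀ s, μ s ≤ ENNReal.ofReal M * volume s)
    (a : ℝ≥0∞) (ha : a < μ Set.univ) (n : ℕ) (β : ℝ) (hβ : 0 < β) :
    ∃ (U' : Set ℝ) (ν : Measure ℝ), IsOpen U' ∧ closure U' ⊆ U ∩ tailSet x r h n ∧ ν U'ᶜ = 0 ∧
      a < ν Set.univ ∧ (∃ M' : ℝ, 0 ≤ M' ∧ ∀ s, ν s ≤ ENNReal.ofReal M' * volume s) ∧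
      (∀ y ρ, ν (Metric.closedBall y ρ) ≤ μ (Metric.closedBall y (ρ + 2 * β))) ∧
      (∀ y ρ, 0 < ρ → ρ ≤ r0 → ν (Metric.closedBall y ρ) ≤ ENNReal.ofReal (20 * M * g ρ)) := by
  classical
  let T : Set (ι × ℝ) := {p | n ≤ h p.1 ∧ 0 < r p.1 ∧ r p.1 ≤ r0 ∧ g (r p.1) ≤ β ∧
    Metric.closedBall (x p.1) (g (r p.1)) ⊆ U ∧ p.2 ∈ Metric.closedBall (x p.1) (g (r p.1))}
  let s : Set ℝ := {t | t ∈ U ∧ ∀ n, ∃ q, n ≤ h q ∧ |t - x q| < g (r q)}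
  have hgpos : ∀ p ∈ T, 0 < g (r p.1) := fun p hp =>
    lt_of_lt_of_le hp.2.1 (G.self _ hp.2.1 hp.2.2.1)
  obtain ⟨u, huT, huc, hud, hus⟩ := Vitali.exists_disjoint_covering_ae volume s T 6
    (fun p => 2 * g (r p.1)) (fun p => p.2) (fun p => Metric.closedBall (x p.1) (g (r p.1)))
    (by
      intro p hp
      apply Metric.closedBall_subset_closedBall'
      have := hp.2.2.2.2.2
      rw [Metric.mem_closedBall, dist_comm] at this
      linarith)
    (by
      intro p hp
      rw [Real.volume_closedBall, Real.volume_closedBall]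
      rw [show ((6 : NNReal) : ℝ≥0∞) = ENNReal.ofReal 6 by simp, ← ENNReal.ofReal_mul (by norm_num)]
      apply ENNReal.ofReal_le_ofReal
      linarith)
    (by
      intro p hp
      rw [interior_closedBall _ (hgpos p hp).ne']
      exact ⟨x p.1, Metric.mem_ball_self (hgpos p hp)⟩)
    (by intro p hp; exact Metric.isClosed_closedBall)
    (by
      rintro t ⟨htU, ht⟩ ε hε
      obtain ⟨η, hη, hηU⟩ := Metric.isOpen_iff.1 hU t htU
      set ε' := min (min (ε / 2) β) (η / 3) with hε'
      have hε'pos : 0 < ε' := by positivity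
      obtain ⟨δ, hδ, hδg⟩ := G.small ε' hε'pos
      obtain ⟨N, hN⟩ := S.r_small (min δ r0) (lt_min hδ G.r0_pos)
      obtain ⟨q, hq, hqt⟩ := ht (max n N)
      have hrq := hN q ((le_max_right _ _).trans hq)
      have hg1 := hδg (r q) (S.r_nonneg q) (hrq.trans (min_le_left _ _))
      have hrpos : 0 < r q := by
        rcases (S.r_nonneg q).lt_or_eq with h1 | h1
        · exact h1
        · rw [← h1, G.zero] at hqt
          exact absurd hqt (not_lt.2 (abs_nonneg _))
      have e1 : ε' ≤ ε / 2 := (min_le_left _ _).trans (min_le_left _ _)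
      have e2 : ε' ≤ β := (min_le_left _ _).trans (min_le_right _ _)
      have e3 : ε' ≤ η / 3 := min_le_right _ _
      refine ⟨(q, t), ⟨(le_max_left _ _).trans hq, hrpos, hrq.trans (min_le_right _ _),
        hg1.trans e2, ?_, ?_⟩, ?_, rfl⟩
      · refine Set.Subset.trans ?_ hηU
        intro z hz
        rw [Metric.mem_closedBall] at hz
        rw [Metric.mem_ball]
        have := dist_triangle z (x q) t
        rw [dist_comm (x q) t, Real.dist_eq t] at this
        dsimp at hz
        linarith
      · rw [Metric.mem_closedBall, Real.dist_eq]; exact hqt.le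
      · dsimp; linarith)
  have hae : ∀ᵐ t : ℝ, t ∈ U → t ∈ s := by
    have := ae_all_iff.2 S.full
    filter_upwards [this] with t ht htU
    exact ⟨htU, fun n => ht n (hUI htU)⟩
  have hac : μ ≪ volume := by
    intro z hz
    have := hμ z
    rw [hz, mul_zero] at this
    exact le_antisymm this zero_le
  have hUs : μ (U \ s) = 0 := by
    apply hac
    rw [ae_iff] at hae
    convert hae using 2
    ext t; simp
  have hmass : μ Set.univ ≤ μ (⋃ p ∈ u, Metric.closedBall (x p.1) (g (r p.1))) := by
    have hsub : (Set.univ : Set ℝ) ⊆ (⋃ p ∈ u, Metric.closedBall (x p.1) (g (r p.1))) ∪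
        (Uᶜ ∪ ((U \ s) ∪ (s \ ⋃ p ∈ u, Metric.closedBall (x p.1) (g (r p.1))))) := by
      intro t _
      by_cases h1 : t ∈ (⋃ p ∈ u, Metric.closedBall (x p.1) (g (r p.1)))
      · exact Or.inl h1
      · by_cases h2 : t ∈ U
        · by_cases h3 : t ∈ s
          · exact Or.inr (Or.inr (Or.inr ⟨h3, h1⟩))
          · exact Or.inr (Or.inr (Or.inl ⟨h2, h3⟩))
        · exact Or.inr (Or.inl h2)
    refine (measure_mono hsub).trans ?_
    refine (measure_union_le _ _).trans ?_
    rw [measure_union_null hμU (measure_union_null hUs (hac hus)), add_zero]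
  rw [measure_biUnion huc hud (fun p _ => measurableSet_closedBall)] at hmass
  have hlt := ha.trans_le hmass
  rw [ENNReal.tsum_eq_iSup_sum, lt_iSup_iff] at hlt
  obtain ⟨F0, hF0⟩ := hlt
  set F : Finset (ι × ℝ) := F0.map (Function.Embedding.subtype _) with hF
  have hFu : ∀ k ∈ F, k ∈ u := by
    intro k hk
    simp only [hF, Finset.mem_map, Function.Embedding.coe_subtype] at hk
    obtain ⟨y, _, rfl⟩ := hk
    exact y.2
  have hsum : a < ∑ k ∈ F, μ (Metric.closedBall (x k.1) (g (r k.1))) := by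
    rw [hF, Finset.sum_map]; exact hF0
  have hrF : ∀ k ∈ F, 0 < r k.1 := fun k hk => (huT (hFu k hk)).2.1
  have hrF0 : ∀ k ∈ F, r k.1 ≤ r0 := fun k hk => (huT (hFu k hk)).2.2.1
  have hdF : (F : Set (ι × ℝ)).PairwiseDisjoint
      (fun k => Metric.closedBall (x k.1) (g (r k.1))) := by
    intro k hk k' hk' hne
    exact hud (hFu k hk) (hFu k' hk') hne
  refine ⟨⋃ k ∈ F, Metric.ball (x k.1) (r k.1 / 2),
    levelMeas g μ F (fun k => x k.1) (fun k => r k.1), ?_, ?_, ?_, ?_, ?_, ?_, ?_⟩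
  · exact isOpen_biUnion fun _ _ => Metric.isOpen_ball
  · have hcl : closure (⋃ k ∈ F, Metric.ball (x k.1) (r k.1 / 2)) ⊆
        ⋃ k ∈ F, Metric.closedBall (x k.1) (r k.1 / 2) := by
      apply closure_minimal
      · exact Set.iUnion₂_mono fun k _ => Metric.ball_subset_closedBall
      · exact F.finite_toSet.isClosed_biUnion fun k _ => Metric.isClosed_closedBall
    refine hcl.trans (Set.iUnion₂_subset ?_)
    intro k hk
    obtain ⟨h1, h2, h3, h4, h5, h6⟩ := huT (hFu k hk)
    have := G.self _ h2 h3
    intro z hz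
    refine ⟨h5 (Metric.closedBall_subset_closedBall (by linarith) hz), k.1, h1, ?_⟩
    rw [Metric.mem_closedBall, Real.dist_eq] at hz
    linarith
  · have hop : IsOpen (⋃ k ∈ F, Metric.ball (x k.1) (r k.1 / 2)) :=
      isOpen_biUnion fun _ _ => Metric.isOpen_ball
    rw [levelMeas_apply _ _ _ _ _ _ hop.measurableSet.compl]
    apply Finset.sum_eq_zero
    intro k hk
    have : (⋃ k ∈ F, Metric.ball (x k.1) (r k.1 / 2))ᶜ ∩ Metric.ball (x k.1) (r k.1 / 2) = ∅ := by
      ext z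
      simp only [Set.mem_inter_iff, Set.mem_compl_iff, Set.mem_empty_iff_false, iff_false, not_and,
        not_not]
      intro hz hz'
      exact hz (Set.mem_biUnion hk hz')
    rw [this]; simp
  · rw [levelMeas_univ _ _ _ _ _ hrF]; exact hsum
  · exact levelMeas_density _ _ _ _ _ hrF
  · intro y ρ
    apply levelMeas_le_of_hit g μ F _ _ hrF hdF _ _ measurableSet_closedBall
    rintro k hk ⟨p, hp1, hp2⟩
    obtain ⟨h1, h2, h3, h4, h5, h6⟩ := huT (hFu k hk)
    have := G.self _ h2 h3
    apply Metric.closedBall_subset_closedBall'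
    rw [Metric.mem_closedBall] at hp1
    rw [Metric.mem_ball] at hp2
    have t1 : dist (x k.1) y ≤ dist (x k.1) p + dist p y := dist_triangle _ _ _
    rw [dist_comm (x k.1) p] at t1
    linarith
  · intro y ρ hρ hρ0
    exact levelMeas_ball_le G μ F _ _ hrF hrF0 hdF M hM hμ y ρ hρ hρ0

lemma multi_level {ι : Type*} {g : ℝ → ℝ} {r0 : ℝ} (G : Gauge g r0) {x r : ι → ℝ} {h : ι → ℕ}
    {I : Set ℝ} (S : Sys g x r h I) (U : Set ℝ) (hU : IsOpen U) (hUI : U ⊆ I)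
    (μ : Measure ℝ) [IsFiniteMeasure μ] (hμU : μ Uᶜ = 0)
    (M : ℝ) (hM : 0 ≤ M) (hμ : ∀ s, μ s ≤ ENNReal.ofReal M * volume s)
    (a : ℝ≥0∞) (ha : a < μ Set.univ) (n : ℕ) (β : ℝ) (hβ : 0 < β)
    (η ρ1 : ℝ) (hη : 0 < η) (hρ1 : ρ1 ≤ r0) (hηρ : ∀ ρ, 0 < ρ → ρ ≤ ρ1 → 6 * M * ρ ≤ η * g ρ)
    (l : ℕ) :
    ∃ (U' : Set ℝ) (ν : Measure ℝ), IsOpen U' ∧ closure U' ⊆ U ∩ tailSet x r h n ∧ ν U'ᶜ = 0 ∧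
      l * a ≤ ν Set.univ ∧ (∃ M' : ℝ, 0 ≤ M' ∧ ∀ s, ν s ≤ ENNReal.ofReal M' * volume s) ∧
      (∀ y ρ, ν (Metric.closedBall y ρ) ≤ l * μ (Metric.closedBall y (ρ + 2 * β))) ∧
      (∀ y ρ, 0 < ρ → ρ ≤ ρ1 → ν (Metric.closedBall y ρ) ≤
        ENNReal.ofReal ((l * η + 20 * M) * g ρ)) := by
  induction l with
  | zero =>
    refine ⟨∅, 0, isOpen_empty, by simp, by simp, by simp, ⟨0, le_rfl, by simp⟩, by simp, by simp⟩
  | succ l ih =>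
    obtain ⟨U1, ν1, hU1, hcl1, hν1, hm1, ⟨M1, hM1, hd1⟩, hb1, hs1⟩ := ih
    obtain ⟨α, hα, hαg⟩ := G.big (2 * M1 / η)
    have hβ' : 0 < min β α := lt_min hβ hα
    obtain ⟨U2, ν2, hU2, hcl2, hν2, hm2, ⟨M2, hM2, hd2⟩, hb2, hs2⟩ :=
      level_exists G S U hU hUI μ hμU M hM hμ a ha n (min β α) hβ'
    refine ⟨U1 ∪ U2, ν1 + ν2, hU1.union hU2, ?_, ?_, ?_, ⟨M1 + M2, by positivity, ?_⟩, ?_, ?_⟩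
    · rw [closure_union]; exact Set.union_subset hcl1 hcl2
    · rw [Measure.add_apply]
      rw [measure_mono_null (Set.compl_subset_compl.2 Set.subset_union_left) hν1,
        measure_mono_null (Set.compl_subset_compl.2 Set.subset_union_right) hν2, add_zero]
    · rw [Measure.add_apply]
      push_cast
      rw [add_mul, one_mul]
      exact add_le_add hm1 hm2.le
    · intro s
      rw [Measure.add_apply, ENNReal.ofReal_add hM1 hM2, add_mul]
      exact add_le_add (hd1 s) (hd2 s)
    · intro y ρ
      rw [Measure.add_apply]
      push_cast
      rw [add_mul, one_mul]
      refine add_le_add (hb1 y ρ) ((hb2 y ρ).trans (measure_mono ?_))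
      apply Metric.closedBall_subset_closedBall
      have := min_le_left β α
      linarith
    · intro y ρ hρ hρle
      have hgρ : 0 ≤ g ρ := hρ.le.trans (G.self ρ hρ (hρle.trans hρ1))
      rw [Measure.add_apply]
      rcases le_or_gt ρ α with hc | hc
      · have e1 : ν1 (Metric.closedBall y ρ) ≤ ENNReal.ofReal (η * g ρ) := by
          refine (hd1 _).trans ?_
          rw [Real.volume_closedBall, ← ENNReal.ofReal_mul hM1]
          apply ENNReal.ofReal_le_ofReal
          have := hαg ρ hρ hc
          rw [div_mul_eq_mul_div, div_le_iff₀ hη] at this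
          linarith
        have e2 := hs2 y ρ hρ (hρle.trans hρ1)
        refine (add_le_add e1 e2).trans ?_
        rw [← ENNReal.ofReal_add (by positivity) (by positivity)]
        apply ENNReal.ofReal_le_ofReal
        push_cast
        have : 0 ≤ l * η * g ρ := by positivity
        nlinarith
      · have e1 := hs1 y ρ hρ hρle
        have e2 : ν2 (Metric.closedBall y ρ) ≤ ENNReal.ofReal (η * g ρ) := by
          refine (hb2 y ρ).trans ((hμ _).trans ?_)
          rw [Real.volume_closedBall, ← ENNReal.ofReal_mul hM]
          apply ENNReal.ofReal_le_ofReal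
          have h1 := hηρ ρ hρ hρle
          have h2 := min_le_right β α
          have h3 : ρ + 2 * min β α ≤ 3 * ρ := by linarith
          nlinarith
        refine (add_le_add e1 e2).trans ?_
        rw [← ENNReal.ofReal_add (by positivity) (by positivity)]
        apply ENNReal.ofReal_le_ofReal
        push_cast
        apply le_of_eq; ring

def GoodSet (g : ℝ → ℝ) (I : Set ℝ) (a : ℝ≥0∞) (b δ : ℝ) (U : Set ℝ) : Prop :=
  IsOpen U ∧ U ⊆ I ∧ ∃ μ : Measure ℝ, IsFiniteMeasure μ ∧ μ Uᶜ = 0 ∧ a < μ Set.univ ∧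
    (∃ M : ℝ, 0 ≤ M ∧ ∀ s, μ s ≤ ENNReal.ofReal M * volume s) ∧
    ∃ c : ℝ, 0 ≤ c ∧ c < b ∧ ∀ y ρ, 0 < ρ → ρ ≤ δ →
      μ (Metric.closedBall y ρ) ≤ ENNReal.ofReal (c * g ρ)

lemma step {ι : Type*} {g : ℝ → ℝ} {r0 : ℝ} (G : Gauge g r0) {x r : ι → ℝ} {h : ι → ℕ}
    {I : Set ℝ} (hI : Bornology.IsBounded I) (S : Sys g x r h I) (a : ℝ≥0∞) (b δ : ℝ) (U : Set ℝ)
    (hGU : GoodSet g I a b δ U) (n : ℕ) :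
    ∃ U', GoodSet g I a b δ U' ∧ closure U' ⊆ U ∩ tailSet x r h n := by
  obtain ⟨hU, hUI, μ, hfin, hμU, ha, ⟨M, hM, hμ⟩, c, hc, hcb, hball⟩ := hGU
  have hb : 0 < b := by linarith
  obtain ⟨a', haa', ha'⟩ := exists_between ha
  obtain ⟨l, hl⟩ := exists_nat_gt (80 * M / b)
  have hlpos : 0 < (l : ℝ) := lt_of_le_of_lt (by positivity) hl
  obtain ⟨ρ1', hρ1', hρ1g⟩ := G.big (6 * M / (b / 4))
  set ρ1 := min ρ1' r0 with hρ1
  have hρ1pos : 0 < ρ1 := lt_min hρ1' G.r0_pos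
  have hgρ1 : 0 < g ρ1 := lt_of_lt_of_le hρ1pos (G.self _ hρ1pos (min_le_right _ _))
  set β := (b - c) / 2 * g ρ1 / (4 * M + 1) with hβ
  have hβpos : 0 < β := by
    have : 0 < b - c := by linarith
    positivity
  have hβM : 4 * M * β ≤ (b - c) / 2 * g ρ1 := by
    have h1 : (4 * M + 1) * β = (b - c) / 2 * g ρ1 := by
      rw [hβ]; field_simp
    linarith
  obtain ⟨U', ν, hU', hcl, hν, hm, ⟨M', hM', hd⟩, hb1, hs1⟩ :=
    multi_level G S U hU hUI μ hμU M hM hμ a' ha' n β hβpos (b / 4) ρ1 (by positivity)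
      (min_le_right _ _) (by
        intro ρ h1 h2
        have := hρ1g ρ h1 (h2.trans (min_le_left _ _))
        rw [div_mul_eq_mul_div, div_le_iff₀ (by positivity)] at this
        linarith) l
  have hl0 : (l : ℝ≥0∞) ≠ 0 := by
    have : (0 : ℝ) < l := hlpos
    simpa using (by exact_mod_cast this.ne' : l ≠ 0)
  have hlt : (l : ℝ≥0∞) ≠ ⊤ := ENNReal.natCast_ne_top l
  have hlinv : (l : ℝ≥0∞)⁻¹ = ENNReal.ofReal ((l : ℝ)⁻¹) := by
    rw [ENNReal.ofReal_inv_of_pos hlpos, ENNReal.ofReal_natCast]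
  have hU'I : U' ⊆ I := subset_closure.trans (hcl.trans (Set.inter_subset_left.trans hUI))
  have hden : ∀ s, ((l : ℝ≥0∞)⁻¹ • ν) s ≤ ENNReal.ofReal ((l : ℝ)⁻¹ * M') * volume s := by
    intro s
    rw [Measure.smul_apply, smul_eq_mul, hlinv, ENNReal.ofReal_mul (by positivity), mul_assoc]
    gcongr
    exact hd s
  refine ⟨U', ⟨hU', hU'I, (l : ℝ≥0∞)⁻¹ • ν, ?_, ?_, ?_, ⟨_, by positivity, hden⟩,
    (b + c) / 2, by linarith, by linarith, ?_⟩, hcl⟩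
  · constructor
    have h1 : ((l : ℝ≥0∞)⁻¹ • ν) Set.univ ≤ ((l : ℝ≥0∞)⁻¹ • ν) U' := by
      have : (Set.univ : Set ℝ) ⊆ U' ∪ U'ᶜ := by simp
      refine (measure_mono this).trans ((measure_union_le _ _).trans ?_)
      rw [Measure.smul_apply _ _ U'ᶜ, hν]; simp
    refine h1.trans_lt ((hden _).trans_lt ?_)
    exact ENNReal.mul_lt_top ENNReal.ofReal_lt_top ((hI.subset hU'I).measure_lt_top)
  · rw [Measure.smul_apply, hν]; simp
  · refine haa'.trans_le ?_
    rw [Measure.smul_apply, smul_eq_mul]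
    calc a' = (l : ℝ≥0∞)⁻¹ * (l * a') := by
            rw [← mul_assoc, ENNReal.inv_mul_cancel hl0 hlt, one_mul]
      _ ≤ _ := by gcongr
  · intro y ρ hρ hρδ
    rw [Measure.smul_apply, smul_eq_mul]
    rcases le_total ρ ρ1 with hle | hle
    · have hgρ : 0 ≤ g ρ := hρ.le.trans (G.self ρ hρ (hle.trans (min_le_right _ _)))
      calc _ ≤ (l : ℝ≥0∞)⁻¹ * ENNReal.ofReal ((l * (b / 4) + 20 * M) * g ρ) := by
            gcongr; exact hs1 y ρ hρ hle
        _ = ENNReal.ofReal ((l : ℝ)⁻¹ * ((l * (b / 4) + 20 * M) * g ρ)) := by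
            rw [hlinv, ← ENNReal.ofReal_mul (by positivity)]
        _ ≤ _ := by
            apply ENNReal.ofReal_le_ofReal
            rw [← mul_assoc]
            apply mul_le_mul_of_nonneg_right _ hgρ
            rw [div_lt_iff₀ hb] at hl
            rw [inv_mul_le_iff₀ hlpos]
            nlinarith
    · have hgρ : g ρ1 ≤ g ρ := G.mono _ _ hρ1pos.le hle
      calc _ ≤ (l : ℝ≥0∞)⁻¹ * (l * μ (Metric.closedBall y (ρ + 2 * β))) := by
            gcongr; exact hb1 y ρ
        _ = μ (Metric.closedBall y (ρ + 2 * β)) := by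
            rw [← mul_assoc, ENNReal.inv_mul_cancel hl0 hlt, one_mul]
        _ ≤ μ (Metric.closedBall y ρ ∪ (Set.Icc (y - ρ - 2 * β) (y - ρ) ∪
              Set.Icc (y + ρ) (y + ρ + 2 * β))) := by
            apply measure_mono
            rw [Real.closedBall_eq_Icc, Real.closedBall_eq_Icc]
            intro z hz
            simp only [Set.mem_union, Set.mem_Icc] at hz ⊢
            by_contra hcon
            push Not at hcon
            obtain ⟨q1, q2, q3⟩ := hcon
            rcases le_total z (y - ρ) with w | w
            · have := q2 (by linarith [hz.1]); linarith
            · rcases le_total (y + ρ) z with w' | w'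
              · have := q3 w'; linarith [hz.2]
              · have := q1 w; linarith
        _ ≤ ENNReal.ofReal (c * g ρ) + (ENNReal.ofReal (M * (2 * β)) + ENNReal.ofReal (M * (2 * β))) := by
            refine (measure_union_le _ _).trans (add_le_add (hball y ρ hρ hρδ) ?_)
            refine (measure_union_le _ _).trans (add_le_add ?_ ?_)
            · refine (hμ _).trans ?_
              rw [Real.volume_Icc, ← ENNReal.ofReal_mul hM]
              apply ENNReal.ofReal_le_ofReal; apply le_of_eq; ring
            · refine (hμ _).trans ?_
              rw [Real.volume_Icc, ← ENNReal.ofReal_mul hM]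
              apply ENNReal.ofReal_le_ofReal; apply le_of_eq; ring
        _ ≤ _ := by
            have : 0 ≤ g ρ := hgρ1.le.trans hgρ
            rw [← ENNReal.ofReal_add (by positivity) (by positivity),
              ← ENNReal.ofReal_add (by positivity) (by positivity)]
            apply ENNReal.ofReal_le_ofReal
            have h2 : (b - c) / 2 * g ρ1 ≤ (b - c) / 2 * g ρ :=
              mul_le_mul_of_nonneg_left hgρ (by linarith)
            nlinarith

lemma cover_open {g : ℝ → ℝ} {r0 : ℝ} (G : Gauge g r0) (b δ : ℝ) (hb : 0 ≤ b) (hδ : 0 < δ)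
    (t : Set ℝ) (ht : Metric.ediam t ≤ ENNReal.ofReal (δ / 2)) (ε : NNReal) (hε : 0 < ε) :
    ∃ V : Set ℝ, IsOpen V ∧ t ⊆ V ∧ ∀ μ : Measure ℝ, (∀ y ρ, 0 < ρ → ρ ≤ δ →
      μ (Metric.closedBall y ρ) ≤ ENNReal.ofReal (b * g ρ)) →
      μ V ≤ ENNReal.ofReal b *
        ((⨆ _ : t.Nonempty, ENNReal.ofReal (g (Metric.ediam t).toReal)) + ε) := by
  rcases t.eq_empty_or_nonempty with rfl | hne
  · exact ⟨∅, isOpen_empty, subset_rfl, by simp⟩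
  obtain ⟨y, hy⟩ := hne
  have hfin : Metric.ediam t ≠ ⊤ := (ht.trans_lt ENNReal.ofReal_lt_top).ne
  set d := (Metric.ediam t).toReal with hd
  have hd0 : 0 ≤ d := ENNReal.toReal_nonneg
  have hdδ : d ≤ δ / 2 := by
    have := ENNReal.toReal_mono ENNReal.ofReal_ne_top ht
    rwa [ENNReal.toReal_ofReal (by positivity)] at this
  have hc : ContinuousWithinAt g (Set.Ici 0) d := G.cont d hd0
  obtain ⟨η, hη, hηg⟩ := Metric.continuousWithinAt_iff.1 hc ε (by exact_mod_cast hε)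
  set d' := d + min (η / 2) (δ / 2) with hd'
  have hm : 0 < min (η / 2) (δ / 2) := by positivity
  have hdd' : d < d' := by linarith
  have hd'δ : d' ≤ δ := by linarith [min_le_right (η / 2) (δ / 2)]
  have hg' : g d' ≤ g d + ε := by
    have := hηg (x := d') (by simp only [Set.mem_Ici]; linarith) (by
      rw [Real.dist_eq, hd', add_sub_cancel_left, abs_of_pos hm]
      linarith [min_le_left (η / 2) (δ / 2)])
    rw [Real.dist_eq] at this
    linarith [(abs_lt.1 this).2]
  refine ⟨Metric.ball y d', Metric.isOpen_ball, ?_, ?_⟩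
  · intro z hz
    rw [Metric.mem_ball]
    refine lt_of_le_of_lt ?_ hdd'
    rw [dist_edist, hd]
    exact ENNReal.toReal_mono hfin (Metric.edist_le_ediam_of_mem hz hy)
  · intro μ hμ
    refine (measure_mono Metric.ball_subset_closedBall).trans ((hμ y d' (by linarith) hd'δ).trans ?_)
    have hgd : 0 ≤ g d := by
      have := G.mono 0 d le_rfl hd0
      rwa [G.zero] at this
    rw [ENNReal.ofReal_mul hb]
    gcongr
    rw [iSup_pos ⟨y, hy⟩]
    calc ENNReal.ofReal (g d') ≤ ENNReal.ofReal (g d + ε) := ENNReal.ofReal_le_ofReal hg'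
      _ = _ := by rw [ENNReal.ofReal_add hgd (by positivity), ENNReal.ofReal_coe_nnreal]

theorem mtp_one {ι : Type*} {g : ℝ → ℝ} {r0 : ℝ} (G : Gauge g r0) {x r : ι → ℝ} {h : ι → ℕ}
    {I : Set ℝ} (hI : Bornology.IsBounded I) (hIo : IsOpen I) (hIpos : 0 < volume I)
    (S : Sys g x r h I) :
    hMeasure g (I ∩ ⋂ n, tailSet x r h n) = ⊤ := by
  by_contra hH
  set A := I ∩ ⋂ n, tailSet x r h n with hA
  set H := hMeasure g A with hHdef
  have hvI : volume I ≠ ⊤ := hI.measure_lt_top.ne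
  set a : ℝ≥0∞ := volume I / 2 with ha
  have hapos : 0 < a := ENNReal.half_pos hIpos.ne'
  have hatop : a ≠ ⊤ := ENNReal.div_ne_top hvI (by norm_num)
  have hH1 : H + 1 ≠ ⊤ := ENNReal.add_ne_top.2 ⟨hH, ENNReal.one_ne_top⟩
  have hH10 : H + 1 ≠ 0 := by simp
  set b : ℝ := (a / (H + 1)).toReal with hb
  have habt : a / (H + 1) ≠ ⊤ := ENNReal.div_ne_top hatop hH10
  have hbpos : 0 < b := ENNReal.toReal_pos (ENNReal.div_pos hapos.ne' hH1).ne' habt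
  have hbH : ENNReal.ofReal b * (H + 1) = a := by
    rw [hb, ENNReal.ofReal_toReal habt, ENNReal.div_mul_cancel hH10 hH1]
  obtain ⟨δ, hδ, hδg⟩ := G.big (2 / (b / 2))
  have hgood0 : GoodSet g I a b δ I := by
    refine ⟨hIo, subset_rfl, volume.restrict I, ⟨by simpa using hvI.lt_top⟩, ?_, ?_,
      ⟨1, zero_le_one, ?_⟩, b / 2, by positivity, by linarith, ?_⟩
    · rw [Measure.restrict_apply hIo.measurableSet.compl]; simp
    · rw [Measure.restrict_apply_univ]; exact ENNReal.half_lt_self hIpos.ne' hvI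
    · intro s; simp only [ENNReal.ofReal_one, one_mul]; exact Measure.restrict_le_self s
    · intro y ρ hρ hρδ
      refine (Measure.restrict_le_self _).trans ?_
      rw [Real.volume_closedBall]
      apply ENNReal.ofReal_le_ofReal
      have := hδg ρ hρ hρδ
      rw [div_mul_eq_mul_div, div_le_iff₀ (by positivity)] at this
      linarith
  have hstep := step G hI S a b δ
  choose! Φ hΦ1 hΦ2 using hstep
  let U : ℕ → Set ℝ := fun n => Nat.rec I (fun n V => Φ V n) n
  have hUs : ∀ n, U (n + 1) = Φ (U n) n := fun n => rfl
  have hUgood : ∀ n, GoodSet g I a b δ (U n) := by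
    intro n
    induction n with
    | zero => exact hgood0
    | succ n ih => rw [hUs]; exact hΦ1 _ ih n
  have hUcl : ∀ n, closure (U (n + 1)) ⊆ U n ∩ tailSet x r h n := by
    intro n; rw [hUs]; exact hΦ2 _ (hUgood n) n
  let K : ℕ → Set ℝ := fun n => closure (U (n + 1))
  have hKanti : Antitone K := by
    apply antitone_nat_of_succ_le
    intro n
    exact ((hUcl (n + 1)).trans Set.inter_subset_left).trans subset_closure
  have hKc : ∀ n, IsCompact (K n) := by
    intro n
    refine Metric.isCompact_of_isClosed_isBounded isClosed_closure ?_
    exact hI.subset (((hUcl n).trans Set.inter_subset_left).trans (hUgood n).2.1)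
  have hKA : ⋂ n, K n ⊆ A := by
    intro z hz
    rw [Set.mem_iInter] at hz
    refine ⟨(hUgood 0).2.1 (hUcl 0 (hz 0)).1, Set.mem_iInter.2 fun n => (hUcl n (hz n)).2⟩
  -- the cover
  have hcov : ⨅ (t : ℕ → Set ℝ) (_ : A ⊆ iUnion t) (_ : ∀ n, Metric.ediam (t n) ≤ ENNReal.ofReal (δ / 2)),
          ∑' n, ⨆ _ : (t n).Nonempty, ENNReal.ofReal (g (Metric.ediam (t n)).toReal) ≤ H := by
    rw [hHdef, hMeasure, Measure.mkMetric_apply]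
    exact le_iSup₂_of_le (ENNReal.ofReal (δ / 2)) (by simpa using hδ) le_rfl
  have hlt : H < H + 1 / 2 := ENNReal.lt_add_right hH (by simp)
  have hcov2 := hcov.trans_lt hlt
  simp only [iInf_lt_iff] at hcov2
  obtain ⟨t, htA, htd, hts⟩ := hcov2
  obtain ⟨ε, hε, hεs⟩ := ENNReal.exists_pos_sum_of_countable (ε := 1 / 2) (by simp) ℕ
  have hV := fun j => cover_open G b δ hbpos.le hδ (t j) (htd j) (ε j) (hε j)
  choose V hVo htV hVμ using hV
  obtain ⟨n, hn⟩ := exists_subset_nhds_of_isCompact (V := K) (U := ⋃ j, V j)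
    (hKanti.directed_ge) hKc (by
      intro z hz
      apply (isOpen_iUnion hVo).mem_nhds
      obtain ⟨j, hj⟩ := Set.mem_iUnion.1 (htA (hKA hz))
      exact Set.mem_iUnion.2 ⟨j, htV j hj⟩)
  obtain ⟨_, _, μ, _, hμU, hμa, _, c, hc, hcb, hball⟩ := hUgood (n + 1)
  have hfinal : μ Set.univ ≤ a := by
    calc μ Set.univ ≤ μ (U (n + 1)) + μ (U (n + 1))ᶜ := by
          rw [← Set.union_compl_self (U (n + 1))]; exact measure_union_le _ _
      _ = μ (U (n + 1)) := by rw [hμU, add_zero]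
      _ ≤ μ (⋃ j, V j) := measure_mono (subset_closure.trans hn)
      _ ≤ ∑' j, μ (V j) := measure_iUnion_le _
      _ ≤ ∑' j, ENNReal.ofReal b *
          ((⨆ _ : (t j).Nonempty, ENNReal.ofReal (g (Metric.ediam (t j)).toReal)) + ε j) := by
          refine ENNReal.tsum_le_tsum fun j => hVμ j μ fun y ρ hρ hρδ => ?_
          refine (hball y ρ hρ hρδ).trans (ENNReal.ofReal_le_ofReal ?_)
          have : 0 ≤ g ρ := by
            have := G.mono 0 ρ le_rfl hρ.le
            rwa [G.zero] at this
          nlinarith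
      _ = ENNReal.ofReal b * (∑' j, (⨆ _ : (t j).Nonempty,
            ENNReal.ofReal (g (Metric.ediam (t j)).toReal)) + ∑' j, (ε j : ℝ≥0∞)) := by
          rw [ENNReal.tsum_mul_left, ENNReal.tsum_add]
      _ ≤ ENNReal.ofReal b * ((H + 1 / 2) + 1 / 2) := by gcongr
      _ = a := by rw [add_assoc, ENNReal.add_halves, hbH]
  exact absurd hμa (not_lt.2 hfinal)

/-! ### The sequence lemma -/

noncomputable def hatc (c : ℕ → ℝ) (j : ℕ) : ℝ := ∑' k : ℕ, (1/2:ℝ)^k * c (j+k)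

noncomputable def Ssum (c : ℕ → ℝ) (j : ℕ) : ℝ := 4 + ∑ i ∈ Finset.range j, hatc c i

section seqlemma
variable {c : ℕ → ℝ}

lemma hatc_summable (h0 : ∀ j, 0 ≤ c j) (h1 : ∀ j, c j ≤ 1) (j : ℕ) :
    Summable (fun k : ℕ => (1/2:ℝ)^k * c (j+k)) := by
  refine Summable.of_nonneg_of_le (fun k => mul_nonneg (by positivity) (h0 _)) (fun k => ?_)
    summable_geometric_two
  exact mul_le_of_le_one_right (by positivity) (h1 _)

lemma hatc_nonneg (h0 : ∀ j, 0 ≤ c j) (j : ℕ) : 0 ≤ hatc c j :=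
  tsum_nonneg fun k => mul_nonneg (by positivity) (h0 _)

lemma hatc_le_two (h0 : ∀ j, 0 ≤ c j) (h1 : ∀ j, c j ≤ 1) (j : ℕ) : hatc c j ≤ 2 := by
  rw [← tsum_geometric_two]
  refine Summable.tsum_le_tsum (fun k => ?_) (hatc_summable h0 h1 j) summable_geometric_two
  exact mul_le_of_le_one_right (by positivity) (h1 _)

lemma hatc_split (h0 : ∀ j, 0 ≤ c j) (h1 : ∀ j, c j ≤ 1) (j m : ℕ) :
    hatc c j = ∑ k ∈ Finset.range m, (1/2:ℝ)^k * c (j+k) + (1/2)^m * hatc c (j+m) := by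
  rw [hatc, ← (hatc_summable h0 h1 j).sum_add_tsum_nat_add m]
  congr 1
  rw [hatc, ← tsum_mul_left]
  refine tsum_congr fun k => ?_
  rw [pow_add, show j + (k+m) = j + m + k by ring]; ring

lemma hatc_ge (h0 : ∀ j, 0 ≤ c j) (h1 : ∀ j, c j ≤ 1) (j : ℕ) : c j ≤ hatc c j := by
  have := hatc_split h0 h1 j 1
  have h2 := hatc_nonneg h0 (j+1)
  simp at this
  linarith

lemma hatc_succ (h0 : ∀ j, 0 ≤ c j) (h1 : ∀ j, c j ≤ 1) (j : ℕ) :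
    hatc c (j+1) ≤ 2 * hatc c j := by
  have := hatc_split h0 h1 j 1
  have h2 := h0 j
  simp at this
  linarith

lemma Ssum_succ (j : ℕ) : Ssum c (j+1) = Ssum c j + hatc c j := by
  simp [Ssum, Finset.sum_range_succ]; ring

lemma Ssum_mono (h0 : ∀ j, 0 ≤ c j) : Monotone (Ssum c) :=
  monotone_nat_of_le_succ fun j => by rw [Ssum_succ]; linarith [hatc_nonneg h0 j]

lemma Ssum_ge (h0 : ∀ j, 0 ≤ c j) (j : ℕ) : 4 ≤ Ssum c j := by
  have := Ssum_mono h0 (Nat.zero_le j)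
  simpa [Ssum] using this

lemma Ssum_add (h0 : ∀ j, 0 ≤ c j) (h1 : ∀ j, c j ≤ 1) (j k : ℕ) :
    Ssum c (j+k) ≤ Ssum c j + 2 * k := by
  induction k with
  | zero => simp
  | succ k ih =>
    rw [← add_assoc, Ssum_succ]; push_cast
    linarith [hatc_le_two h0 h1 (j+k)]

lemma seq_u_summable (h0 : ∀ j, 0 ≤ c j) :
    Summable (fun i => hatc c i / (Ssum c (i+1) * √(Ssum c (i+1)))) := by
  have hS := Ssum_ge h0
  refine summable_of_sum_range_le (c := 2 * (1 / √(Ssum c 0))) (fun i => ?_) (fun n => ?_)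
  · have := hS (i+1); have := hatc_nonneg h0 i; positivity
  · have key : ∀ n, ∑ i ∈ Finset.range n, hatc c i / (Ssum c (i+1) * √(Ssum c (i+1))) ≤
        2 * (1 / √(Ssum c 0)) - 2 * (1 / √(Ssum c n)) := by
      intro n
      induction n with
      | zero => simp
      | succ n ih =>
        rw [Finset.sum_range_succ]
        have hx : 0 < √(Ssum c n) := Real.sqrt_pos.2 (by linarith [hS n])
        have hxy : √(Ssum c n) ≤ √(Ssum c (n+1)) := Real.sqrt_le_sqrt (Ssum_mono h0 (Nat.le_succ n))
        have e1 : √(Ssum c n) ^ 2 = Ssum c n := Real.sq_sqrt (by linarith [hS n])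
        have e2 : √(Ssum c (n+1)) ^ 2 = Ssum c (n+1) := Real.sq_sqrt (by linarith [hS (n+1)])
        have e3 : hatc c n = √(Ssum c (n+1)) ^ 2 - √(Ssum c n) ^ 2 := by
          rw [e1, e2, Ssum_succ]; ring
        rw [e3, show Ssum c (n+1) * √(Ssum c (n+1)) = √(Ssum c (n+1)) ^ 3 by
          rw [pow_succ, e2]]
        set x := √(Ssum c n)
        set y := √(Ssum c (n+1))
        have hy : 0 < y := hx.trans_le hxy
        have : (y^2 - x^2) / y^3 ≤ 2 * (1/x) - 2 * (1/y) := by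
          rw [show 2 * (1/x) - 2 * (1/y) = (2 * (y - x)) / (x*y) by field_simp,
            div_le_div_iff₀ (by positivity) (by positivity)]
          have h3 : 0 ≤ y - x := by linarith
          have h4 : (y + x) * x ≤ 2 * y^2 := by nlinarith
          have h5 := mul_le_mul_of_nonneg_left h4 (mul_nonneg h3 hy.le)
          nlinarith
        linarith
    have := key n
    have h2 : 0 ≤ 2 * (1 / √(Ssum c n)) := by positivity
    linarith

noncomputable def mlog (c : ℕ → ℝ) (j : ℕ) : ℕ := Nat.log 4 ⌊Ssum c j⌋₊

lemma bad_bound (h0 : ∀ j, 0 ≤ c j) (h1 : ∀ j, c j ≤ 1) (h8 : ∀ j, c (j+1) ≤ 8 * c j) (j : ℕ)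
    (hbad : c j < hatc c j / Ssum c j) :
    hatc c j / Ssum c j ≤ 18 * (hatc c (j + mlog c j) /
      (Ssum c (j + mlog c j + 1) * √(Ssum c (j + mlog c j +1)))) := by
  have hS := Ssum_ge h0 j
  have hS0 : (0:ℝ) < Ssum c j := by linarith
  have hfl : ⌊Ssum c j⌋₊ ≠ 0 := by
    have : (4:ℕ) ≤ ⌊Ssum c j⌋₊ := Nat.le_floor (by simpa using hS)
    omega
  have hm1 : (4:ℝ) ^ mlog c j ≤ Ssum c j := by
    have := Nat.pow_log_le_self 4 hfl
    calc (4:ℝ) ^ mlog c j = ((4 ^ mlog c j : ℕ) : ℝ) := by push_cast; rfl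
      _ ≤ (⌊Ssum c j⌋₊ : ℝ) := by exact_mod_cast this
      _ ≤ _ := Nat.floor_le hS0.le
  have hm2 : Ssum c j < (4:ℝ) ^ (mlog c j + 1) := by
    have := Nat.lt_pow_succ_log_self (b := 4) (by norm_num) ⌊Ssum c j⌋₊
    have h2 := (Nat.floor_lt hS0.le).1 this
    simpa [mlog] using h2
  generalize mlog c j = m at *
  have h8k : ∀ k, c (j+k) ≤ 8^k * c j := by
    intro k
    induction k with
    | zero => simp
    | succ k ih => rw [← add_assoc, pow_succ]; linarith [h8 (j+k)]
  have hsum : ∑ k ∈ Finset.range m, (1/2:ℝ)^k * c (j+k) ≤ hatc c j / 3 := by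
    have : ∑ k ∈ Finset.range m, (1/2:ℝ)^k * c (j+k) ≤ ∑ k ∈ Finset.range m, (4:ℝ)^k * c j := by
      refine Finset.sum_le_sum fun k _ => ?_
      calc (1/2:ℝ)^k * c (j+k) ≤ (1/2:ℝ)^k * (8^k * c j) := by
            have := h8k k; gcongr
        _ = (4:ℝ)^k * c j := by rw [← mul_assoc, ← mul_pow]; norm_num
    rw [← Finset.sum_mul, geom_sum_eq (by norm_num)] at this
    rw [lt_div_iff₀ hS0] at hbad
    have h3 := mul_le_mul_of_nonneg_right hm1 (h0 j)
    have := h0 j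
    nlinarith
  have hsp := hatc_split h0 h1 j m
  have hle : hatc c j ≤ 3/2 * ((1/2)^m * hatc c (j+m)) := by linarith
  have hsq : (1/2:ℝ)^m * √(Ssum c j) ≤ 2 := by
    have : √(Ssum c j) ≤ 2 ^ (m+1) := by
      rw [Real.sqrt_le_left (by positivity)]
      refine hm2.le.trans (le_of_eq ?_)
      rw [← pow_mul, mul_comm, pow_mul]; norm_num
    calc (1/2:ℝ)^m * √(Ssum c j) ≤ (1/2:ℝ)^m * 2 ^ (m+1) := by gcongr
      _ = 2 := by rw [pow_succ, ← mul_assoc, ← mul_pow]; norm_num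
  have hm4 : (m:ℝ) + 1 ≤ 4^m := by
    have : m + 1 ≤ 4 ^ m := Nat.lt_pow_self (by norm_num)
    exact_mod_cast this
  have hS3 : Ssum c (j+m+1) ≤ 3 * Ssum c j := by
    have := Ssum_add h0 h1 j (m+1)
    push_cast at this
    rw [← add_assoc] at this
    linarith
  have hT := Ssum_ge h0 (j+m+1)
  set T := Ssum c (j+m+1)
  set S := Ssum c j
  have hsT : √T ≤ 2 * √S := by
    have : √T ≤ √(2^2 * S) := Real.sqrt_le_sqrt (by linarith)
    rwa [Real.sqrt_mul (by norm_num), Real.sqrt_sq (by norm_num)] at this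
  have hz := hatc_nonneg h0 (j+m)
  have hsS : 0 < √S := Real.sqrt_pos.2 hS0
  have hsT0 : 0 < √T := Real.sqrt_pos.2 (by linarith)
  have hTT : T * √T ≤ 6 * (S * √S) := by
    calc T * √T ≤ (3 * S) * (2 * √S) := by gcongr
      _ = _ := by ring
  rw [← mul_div_assoc, div_le_div_iff₀ hS0 (by positivity)]
  calc hatc c j * (T * √T) ≤ (3/2 * ((1/2)^m * hatc c (j+m))) * (6 * (S * √S)) := by
        gcongr
    _ = 9 * hatc c (j+m) * S * ((1/2)^m * √S) := by ring
    _ ≤ 9 * hatc c (j+m) * S * 2 := by gcongr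
    _ = _ := by ring

lemma seq_lemma (h0 : ∀ j, 0 ≤ c j) (h1 : ∀ j, c j ≤ 1) (h8 : ∀ j, c (j+1) ≤ 8 * c j)
    (hdiv : ¬ Summable c) :
    ∃ b : ℕ → ℝ, (∀ j, 0 ≤ b j) ∧ (∀ j, b j ≤ 1) ∧ (∀ j, b (j+1) ≤ 2 * b j) ∧ ¬ Summable b ∧
      Summable (fun j => if c j < b j then b j else 0) := by
  have hS := Ssum_ge h0
  have hb0 : ∀ j, 0 ≤ hatc c j / Ssum c j := fun j =>
    div_nonneg (hatc_nonneg h0 j) (by linarith [hS j])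
  refine ⟨fun j => hatc c j / Ssum c j, hb0, fun j => ?_, fun j => ?_, ?_, ?_⟩
  · rw [div_le_one (by linarith [hS j])]
    linarith [hS j, hatc_le_two h0 h1 j]
  · rw [← mul_div_assoc]
    have := hatc_nonneg h0 j
    exact div_le_div₀ (by positivity) (hatc_succ h0 h1 j) (by linarith [hS j])
      (Ssum_mono h0 (Nat.le_succ j))
  · intro hsum
    apply hdiv
    have key : ∀ n, Ssum c n ≤ 4 * Real.exp (∑ i ∈ Finset.range n, hatc c i / Ssum c i) := by
      intro n
      induction n with
      | zero => simp [Ssum]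
      | succ n ih =>
        rw [Finset.sum_range_succ, Real.exp_add, Ssum_succ]
        have hp : 0 < Ssum c n := by linarith [hS n]
        calc Ssum c n + hatc c n = Ssum c n * (hatc c n / Ssum c n + 1) := by field_simp; ring
          _ ≤ Ssum c n * Real.exp (hatc c n / Ssum c n) := by
            gcongr; exact Real.add_one_le_exp _
          _ ≤ _ := by rw [← mul_assoc]; gcongr
    refine summable_of_sum_range_le (c := 4 * Real.exp (∑' i, hatc c i / Ssum c i)) h0 fun n => ?_
    calc ∑ i ∈ Finset.range n, c i ≤ ∑ i ∈ Finset.range n, hatc c i :=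
          Finset.sum_le_sum fun i _ => hatc_ge h0 h1 i
      _ ≤ Ssum c n := by simp [Ssum]
      _ ≤ _ := key n
      _ ≤ _ := by
        gcongr
        exact hsum.sum_le_tsum _ fun i _ => hb0 i
  · have hinj : Function.Injective (fun j => j + mlog c j) := by
      apply StrictMono.injective
      apply strictMono_nat_of_lt_succ
      intro j
      have : mlog c j ≤ mlog c (j+1) :=
        Nat.log_mono_right (Nat.floor_mono (Ssum_mono h0 (Nat.le_succ j)))
      omega
    have hu := ((seq_u_summable h0).comp_injective hinj).mul_left 18
    refine Summable.of_nonneg_of_le (fun j => ?_) (fun j => ?_) hu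
    · split_ifs
      · exact hb0 j
      · exact le_rfl
    · split_ifs with hbad
      · exact bad_bound h0 h1 h8 j hbad
      · have := hatc_nonneg h0 (j + mlog c j)
        have := hS (j + mlog c j + 1)
        simp only [Function.comp]
        positivity

end seqlemma

lemma block_summable {F D : ℕ → ℝ} (hF : ∀ h, 0 ≤ F h) (hD0 : ∀ j, 0 ≤ D j) (hD : Summable D)
    (hFD : ∀ h, 1 ≤ h → F h ≤ D (Nat.log 2 h) / 2 ^ Nat.log 2 h) : Summable F := by
  have key : ∀ n, ∑ h ∈ Finset.range (2^n), F h ≤ F 0 + ∑ j ∈ Finset.range n, D j := by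
    intro n
    induction n with
    | zero => simp
    | succ n ih =>
      rw [Finset.sum_range_succ, ← Finset.sum_range_add_sum_Ico F
        (Nat.pow_le_pow_right (by norm_num : 0 < 2) (Nat.le_succ n))]
      have : ∑ h ∈ Finset.Ico (2^n) (2^(n+1)), F h ≤
          ∑ h ∈ Finset.Ico (2^n) (2^(n+1)), D n / 2^n := by
        refine Finset.sum_le_sum fun h hh => ?_
        rw [Finset.mem_Ico] at hh
        have hlog : Nat.log 2 h = n := Nat.log_eq_of_pow_le_of_lt_pow hh.1 hh.2
        have := hFD h (Nat.one_le_two_pow.trans hh.1)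
        rwa [hlog] at this
      rw [Finset.sum_const, Nat.card_Ico, show 2^(n+1) - 2^n = 2^n by rw [pow_succ]; omega,
        nsmul_eq_mul] at this
      push_cast at this
      rw [mul_div_cancel₀ _ (by positivity)] at this
      linarith
  refine summable_of_sum_range_le (c := F 0 + ∑' j, D j) hF fun n => ?_
  calc ∑ h ∈ Finset.range n, F h ≤ ∑ h ∈ Finset.range (2^n), F h := by
        refine Finset.sum_le_sum_of_subset_of_nonneg ?_ fun h _ _ => hF h
        exact Finset.range_subset_range.2 Nat.lt_two_pow_self.le
    _ ≤ _ := key n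
    _ ≤ _ := by gcongr; exact hD.sum_le_tsum _ fun j _ => hD0 j

lemma theta_exists (w : ℕ → ℝ) (w0 : ∀ h, 0 ≤ w h) (wanti : ∀ h k, 1 ≤ h → h ≤ k → w k ≤ w h)
    (hdiv : ¬ Summable (fun h : ℕ => (h:ℝ)^2 * w h)) :
    ∃ B : ℕ → ℝ, (∀ h, 0 ≤ B h) ∧ (∀ h, B h ≤ 1) ∧ Antitone B ∧
      Tendsto B atTop (nhds 0) ∧ ¬ Summable B ∧
      Summable (fun h : ℕ => if B h ≤ (h:ℝ)^2 * w h then 0 else B h) := by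
  set c : ℕ → ℝ := fun j => min (8^j * w (2^(j+1))) 1 with hc
  have c0 : ∀ j, 0 ≤ c j := fun j => le_min (mul_nonneg (by positivity) (w0 _)) zero_le_one
  have c1 : ∀ j, c j ≤ 1 := fun j => min_le_right _ _
  have c8 : ∀ j, c (j+1) ≤ 8 * c j := by
    intro j
    have hw : w (2^(j+1+1)) ≤ w (2^(j+1)) :=
      wanti _ _ Nat.one_le_two_pow (Nat.pow_le_pow_right (by norm_num) (by omega))
    simp only [hc]
    rw [mul_min_of_nonneg _ _ (by norm_num : (0:ℝ) ≤ 8)]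
    refine le_min ((min_le_left _ _).trans ?_) ((min_le_right _ _).trans (by norm_num))
    rw [pow_succ, ← mul_assoc, mul_comm (8:ℝ) (8^j)]
    gcongr
  have cdiv : ¬ Summable c := by
    intro hs
    apply hdiv
    have hev : ∀ᶠ j in atTop, c j < 1 := hs.tendsto_atTop_zero.eventually_lt_const zero_lt_one
    have hev2 : ∀ᶠ j in atTop, c j = 8^j * w (2^(j+1)) := by
      filter_upwards [hev] with j hj
      simp only [hc] at hj ⊢
      rcases min_lt_iff.1 hj with h | h
      · exact min_eq_left h.le
      · exact absurd h (lt_irrefl _)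
    have hs2 : Summable (fun j : ℕ => 8^j * w (2^(j+1))) := by
      refine (summable_congr_cofinite ?_).1 hs
      rwa [Nat.cofinite_eq_atTop]
    have hs3 : Summable (fun j : ℕ => 4 * (8^j * w (2^j))) := by
      rw [← summable_nat_add_iff 1]
      refine (hs2.mul_left 32).congr fun j => ?_
      rw [pow_succ (8:ℝ)]; ring
    refine block_summable (fun h => mul_nonneg (by positivity) (w0 _))
      (fun j => mul_nonneg (by norm_num) (mul_nonneg (by positivity) (w0 _))) hs3 fun h hh => ?_
    have hl1 := Nat.pow_log_le_self 2 (by omega : h ≠ 0)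
    have hl2 := Nat.lt_pow_succ_log_self (b := 2) (by norm_num) h
    set j := Nat.log 2 h
    rw [le_div_iff₀ (by positivity)]
    have hr : (h:ℝ) ≤ 2 * 2^j := by
      have : h ≤ 2 * 2^j := by rw [pow_succ] at hl2; omega
      exact_mod_cast this
    have hw := wanti _ _ Nat.one_le_two_pow hl1
    calc (h:ℝ)^2 * w h * 2^j ≤ (2*2^j)^2 * w (2^j) * 2^j := by
          have := w0 h; have := w0 (2^j)
          gcongr
      _ = 4 * ((2^j * 2^j * 2^j) * w (2^j)) := by ring
      _ = _ := by rw [← mul_pow, ← mul_pow]; norm_num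
  obtain ⟨b, b0, b1, b2, bdiv, bbad⟩ := seq_lemma c0 c1 c8 cdiv
  set B : ℕ → ℝ := fun h => b (Nat.log 2 h) / 2 ^ Nat.log 2 h with hB
  have B0 : ∀ h, 0 ≤ B h := fun h => div_nonneg (b0 _) (by positivity)
  have Banti : Antitone B := by
    have : Antitone (fun j => b j / 2 ^ j) := antitone_nat_of_succ_le fun j => by
      rw [pow_succ, div_le_div_iff₀ (by positivity) (by positivity)]
      have := b2 j
      have h2 : (0:ℝ) < 2^j := by positivity
      nlinarith
    exact fun h k hk => this (Nat.log_mono_right hk)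
  refine ⟨B, B0, fun h => ?_, Banti, ?_, ?_, ?_⟩
  · exact div_le_one_of_le₀ ((b1 _).trans (one_le_pow₀ (by norm_num))) (by positivity)
  · have hz : Tendsto (fun n : ℕ => 2 * (1 / ((n:ℝ) + 1))) atTop (nhds 0) := by
      simpa using (tendsto_one_div_add_atTop_nhds_zero_nat (𝕜 := ℝ)).const_mul 2
    refine squeeze_zero B0 (fun h => ?_) hz
    have hl2 := Nat.lt_pow_succ_log_self (b := 2) (by norm_num) h
    simp only [hB]
    rw [mul_one_div, div_le_div_iff₀ (by positivity) (by positivity)]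
    have : (h:ℝ) + 1 ≤ 2 * 2 ^ Nat.log 2 h := by
      have : h + 1 ≤ 2 * 2^Nat.log 2 h := by rw [pow_succ] at hl2; omega
      exact_mod_cast this
    have hb := b1 (Nat.log 2 h)
    have hb' := b0 (Nat.log 2 h)
    nlinarith
  · intro hs
    apply bdiv
    rw [← summable_condensed_iff_of_nonneg B0 (fun m n _ h => Banti h)] at hs
    refine hs.congr fun j => ?_
    simp only [hB, Nat.log_pow (by norm_num : 1 < 2)]
    rw [mul_div_cancel₀ _ (by positivity)]
  · refine block_summable (fun h => ?_) (fun j => ?_) bbad fun h hh => ?_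
    · split_ifs
      · exact le_rfl
      · exact B0 h
    · split_ifs
      · exact b0 j
      · exact le_rfl
    · have hl1 := Nat.pow_log_le_self 2 (by omega : h ≠ 0)
      have hl2 := Nat.lt_pow_succ_log_self (b := 2) (by norm_num) h
      split_ifs with h1 h2 h2
      · exact div_nonneg (b0 _) (by positivity)
      · simp
      · exact le_rfl
      · exfalso
        apply h1
        push Not at h2
        simp only [hB]
        set j := Nat.log 2 h
        have h3 : b j ≤ 8^j * w (2^(j+1)) := h2.trans (min_le_left _ _)
        have hw := wanti _ _ hh hl2.le
        have hr : (2:ℝ)^j ≤ h := by exact_mod_cast hl1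
        rw [div_le_iff₀ (by positivity)]
        calc b j ≤ 8^j * w (2^(j+1)) := h3
          _ ≤ 8^j * w h := by gcongr
          _ = (2^j)^2 * w h * 2^j := by
            rw [show (8:ℝ) = 2*2*2 by norm_num, mul_pow, mul_pow]; ring
          _ ≤ _ := by
            have := w0 h
            gcongr

/-! ### Slicing -/

lemma slicing {f g : ℝ → ℝ} (fg : ∀ r, 0 ≤ r → f r = r * g r) (gz : g 0 = 0)
    (g0 : ∀ r, 0 ≤ r → 0 ≤ g r) (gm : ∀ r s, 0 ≤ r → r ≤ s → g r ≤ g s)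
    (A : Set (EuclideanSpace ℝ (Fin 2))) (hA : hMeasure f A ≠ ⊤) :
    ∀ᵐ s : ℝ, hMeasure g {t : ℝ | !₂[s+t, t] ∈ A} ≠ ⊤ := by
  classical
  have hcov : ∀ n : ℕ, ∃ t : ℕ → Set (EuclideanSpace ℝ (Fin 2)), A ⊆ iUnion t ∧
      (∀ i, Metric.ediam (t i) ≤ (((n:ℝ≥0∞) + 1)⁻¹)) ∧
      ∑' i, ENNReal.ofReal (f (Metric.ediam (t i)).toReal) ≤ hMeasure f A + 1 := by
    intro n
    have hlt : hMeasure f A < hMeasure f A + 1 := ENNReal.lt_add_right hA one_ne_zero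
    have hpos : (0:ℝ≥0∞) < ((n:ℝ≥0∞) + 1)⁻¹ := by
      rw [ENNReal.inv_pos]
      exact ENNReal.add_ne_top.2 ⟨ENNReal.natCast_ne_top n, ENNReal.one_ne_top⟩
    have h1 := (le_iSup₂ (f := fun (r : ℝ≥0∞) (_ : 0 < r) =>
      ⨅ (t : ℕ → Set (EuclideanSpace ℝ (Fin 2))) (_ : A ⊆ iUnion t) (_ : ∀ n, Metric.ediam (t n) ≤ r),
          ∑' n, ⨆ _ : (t n).Nonempty, ENNReal.ofReal (f (Metric.ediam (t n)).toReal)) _ hpos).trans_eq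
        (Measure.mkMetric_apply (fun d => ENNReal.ofReal (f d.toReal)) A).symm
    have h2 := h1.trans_lt hlt
    simp only [iInf_lt_iff] at h2
    obtain ⟨t, ht1, ht2, ht3⟩ := h2
    refine ⟨t, ht1, ht2, le_trans (le_of_eq ?_) ht3.le⟩
    refine tsum_congr fun i => ?_
    rcases (t i).eq_empty_or_nonempty with h | h
    · simp [h, fg 0 le_rfl]
    · simp [h]
  choose t ht1 ht2 ht3 using hcov
  set d : ℕ → ℕ → ℝ := fun n i => (Metric.ediam (t n i)).toReal with hd
  have hdtop : ∀ n i, Metric.ediam (t n i) ≠ ⊤ := fun n i => ne_top_of_le_ne_top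
    (by simp) (ht2 n i)
  set y : ℕ → ℕ → ℝ := fun n i => if h : (t n i).Nonempty then (h.some 0 - h.some 1) else 0 with hy
  set φ : ℕ → ℝ → ℝ≥0∞ := fun n s => ∑' i, (Metric.closedBall (y n i) (2 * d n i)).indicator
    (fun _ => ENNReal.ofReal (g (d n i))) s with hφ
  have hφm : ∀ n, Measurable (φ n) := fun n => Measurable.tsum fun i =>
    measurable_const.indicator Metric.isClosed_closedBall.measurableSet
  have hφi : ∀ n, ∫⁻ s, φ n s ≤ 4 * (hMeasure f A + 1) := by
    intro n
    simp only [hφ]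
    rw [lintegral_tsum fun i => (measurable_const.indicator
      Metric.isClosed_closedBall.measurableSet).aemeasurable]
    refine le_trans (le_of_eq ?_) (mul_le_mul_right (ht3 n) 4)
    rw [← ENNReal.tsum_mul_left]
    refine tsum_congr fun i => ?_
    have hd0 : 0 ≤ d n i := ENNReal.toReal_nonneg
    rw [lintegral_indicator Metric.isClosed_closedBall.measurableSet, setLIntegral_const,
      Real.volume_closedBall, fg _ hd0, ← ENNReal.ofReal_mul (g0 _ hd0),
      show (4:ℝ≥0∞) = ENNReal.ofReal 4 by simp, ← ENNReal.ofReal_mul (by norm_num)]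
    congr 1; simp only [hd]; ring
  have hlim : ∫⁻ s, liminf (fun n => φ n s) atTop ≤ 4 * (hMeasure f A + 1) := by
    refine (lintegral_liminf_le hφm).trans ?_
    refine (liminf_le_liminf (Eventually.of_forall hφi)).trans ?_
    simp
  have hfin : ∀ᵐ s : ℝ, liminf (fun n => φ n s) atTop < ⊤ := by
    refine ae_lt_top (Measurable.liminf hφm) (ne_top_of_le_ne_top ?_ hlim)
    exact ENNReal.mul_ne_top (by simp) (ENNReal.add_ne_top.2 ⟨hA, by simp⟩)
  filter_upwards [hfin] with s hs
  refine ne_top_of_le_ne_top hs.ne ?_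
  have hds : ∀ n i, Metric.ediam {u : ℝ | !₂[s+u, u] ∈ t n i} ≤ Metric.ediam (t n i) := by
    intro n i
    refine Metric.ediam_le fun u hu v hv => ?_
    refine le_trans ?_ (Metric.edist_le_ediam_of_mem hu hv)
    rw [edist_dist, edist_dist]
    apply ENNReal.ofReal_le_ofReal
    rw [EuclideanSpace.dist_eq]
    apply Real.le_sqrt_of_sq_le
    simp [Fin.sum_univ_two]
  have hz : Tendsto (fun n : ℕ => ((n:ℝ≥0∞)+1)⁻¹) atTop (nhds 0) := by
    have := (tendsto_add_atTop_iff_nat 1).2 ENNReal.tendsto_inv_nat_nhds_zero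
    simpa using this
  refine (Measure.mkMetric_le_liminf_tsum (ι := fun _ : ℕ => ℕ) _
    (fun n : ℕ => ((n:ℝ≥0∞)+1)⁻¹) hz (fun n i => {u : ℝ | !₂[s+u, u] ∈ t n i})
    (Eventually.of_forall fun n i => (hds n i).trans (ht2 n i))
    (Eventually.of_forall fun n u hu => ?_) _).trans ?_
  · have := ht1 n hu
    simpa using this
  · refine liminf_le_liminf (Eventually.of_forall fun n => ?_)
    refine ENNReal.tsum_le_tsum fun i => ?_
    rcases Set.eq_empty_or_nonempty {u : ℝ | !₂[s+u, u] ∈ t n i} with h | ⟨u, hu⟩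
    · rw [h]; simp [gz]
    · have hne : (t n i).Nonempty := ⟨_, hu⟩
      have hmem : s ∈ Metric.closedBall (y n i) (2 * d n i) := by
        have hdist : dist !₂[s+u, u] hne.some ≤ d n i := by
          have := Metric.edist_le_ediam_of_mem (show !₂[s+u, u] ∈ t n i from hu) hne.some_mem
          rw [edist_dist] at this
          exact (ENNReal.ofReal_le_iff_le_toReal (hdtop n i)).1 this
        have hc : ∀ k, |(!₂[s+u, u] : EuclideanSpace ℝ (Fin 2)) k - hne.some k| ≤ d n i := by
          intro k
          refine le_trans ?_ hdist
          rw [EuclideanSpace.dist_eq]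
          apply Real.le_sqrt_of_sq_le
          rw [← Real.dist_eq]
          exact Finset.single_le_sum (f := fun k => dist ((!₂[s+u, u] : EuclideanSpace ℝ (Fin 2)) k) (hne.some k) ^ 2)
            (fun _ _ => by positivity) (Finset.mem_univ k)
        have c0 := hc 0
        have c1 := hc 1
        simp only [hy, dif_pos hne, Metric.mem_closedBall, Real.dist_eq]
        simp at c0 c1
        rw [abs_le] at *
        constructor <;> linarith [c0.1, c0.2, c1.1, c1.2]
      rw [Set.indicator_of_mem hmem]
      apply ENNReal.ofReal_le_ofReal
      exact gm _ _ ENNReal.toReal_nonneg (ENNReal.toReal_mono (hdtop n i) (hds n i))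

lemma ae_slices {A : Set (EuclideanSpace ℝ (Fin 2))} (hA : volume A = 0) :
    ∀ᵐ s : ℝ, ∀ᵐ t : ℝ, !₂[s+t, t] ∉ A := by
  have m1 : MeasurePreserving (fun z : ℝ × ℝ => (z.2 + z.1, z.2))
      (volume.prod volume) (volume.prod volume) :=
    (Measure.measurePreserving_swap (μ := (volume : Measure ℝ)) (ν := (volume : Measure ℝ))).comp
      (measurePreserving_prod_add_swap (volume : Measure ℝ) (volume : Measure ℝ))
  have m2 := (PiLp.volume_preserving_toLp (Fin 2)).comp
    ((volume_preserving_finTwoArrow ℝ).symm.comp m1)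
  have h := m2.quasiMeasurePreserving.ae (p := fun x => x ∉ A) (measure_eq_zero_iff_ae_notMem.1 hA)
  have h2 := Measure.ae_ae_of_ae_prod h
  filter_upwards [h2] with s hs
  filter_upwards [hs] with t ht
  have e : (WithLp.toLp 2 ∘ ⇑(MeasurableEquiv.finTwoArrow (α := ℝ)).symm ∘ fun z : ℝ × ℝ => (z.2 + z.1, z.2)) (s, t)
      = (!₂[s+t, t] : EuclideanSpace ℝ (Fin 2)) := by
    ext i
    fin_cases i <;> simp [MeasurableEquiv.finTwoArrow, add_comm]
  rw [← e]; exact ht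

/-! ### Slices of the approximating sets -/

def ht (q : (Fin 2 → ℤ) × ℤ) : ℕ := max (q.1 0).natAbs (q.1 1).natAbs

def lf (s t : ℝ) (q : (Fin 2 → ℤ) × ℤ) : ℝ :=
  (q.1 0 : ℝ)^2 * (s+t) + (q.1 1 : ℝ)^2 * t - (q.2 : ℝ)^2

lemma lf_sq_bound {s t ω : ℝ} (hs : s ∈ Ioo (0:ℝ) (1/2)) (ht' : t ∈ Ioo (0:ℝ) (1/2))
    (hω : ω ≤ 1) {q : (Fin 2 → ℤ) × ℤ} (hq : |lf s t q| < ω) :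
    (q.2 : ℝ)^2 < 1 + 2 * (ht q : ℝ)^2 := by
  have h0 : (q.1 0 : ℝ)^2 ≤ (ht q : ℝ)^2 := by
    rw [← sq_abs, ← Int.cast_abs, Int.abs_eq_natAbs, Int.cast_natCast]
    have : (q.1 0).natAbs ≤ ht q := le_max_left _ _
    gcongr
  have h1 : (q.1 1 : ℝ)^2 ≤ (ht q : ℝ)^2 := by
    rw [← sq_abs, ← Int.cast_abs, Int.abs_eq_natAbs, Int.cast_natCast]
    have : (q.1 1).natAbs ≤ ht q := le_max_right _ _
    gcongr
  rw [abs_lt, lf] at hq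
  obtain ⟨hs0, hs1⟩ := hs
  obtain ⟨ht0, ht1⟩ := ht'
  have a0 := sq_nonneg (q.1 0 : ℝ)
  have a1 := sq_nonneg (q.1 1 : ℝ)
  have e0 : (q.1 0 : ℝ)^2 * (s+t) ≤ (q.1 0 : ℝ)^2 * 1 := by gcongr; linarith
  have e1 : (q.1 1 : ℝ)^2 * t ≤ (q.1 1 : ℝ)^2 * 1 := by gcongr; linarith
  linarith [hq.1]

def Tset (s ω : ℝ) (α β p : ℕ) : Set ℝ := {t | |(α:ℝ)^2 * (s+t) + (β:ℝ)^2 * t - (p:ℝ)^2| < ω}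

lemma volume_Tset_le {s ω : ℝ} {α β p h : ℕ} (hω : 0 ≤ ω) (hh : 1 ≤ h) (hab : h ≤ α ∨ h ≤ β) :
    volume (Tset s ω α β p) ≤ ENNReal.ofReal (2 * (ω / (h:ℝ)^2)) := by
  have hh' : (1:ℝ) ≤ h := by exact_mod_cast hh
  have hA : (h:ℝ)^2 ≤ (α:ℝ)^2 + (β:ℝ)^2 := by
    rcases hab with h' | h'
    · have : (h:ℝ) ≤ α := by exact_mod_cast h'
      nlinarith [sq_nonneg (β:ℝ)]
    · have : (h:ℝ) ≤ β := by exact_mod_cast h'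
      nlinarith [sq_nonneg (α:ℝ)]
  have hA0 : 0 < (α:ℝ)^2 + (β:ℝ)^2 := by nlinarith
  rw [← Real.volume_ball (((p:ℝ)^2 - (α:ℝ)^2 * s) / ((α:ℝ)^2 + (β:ℝ)^2))]
  refine measure_mono fun t ht => ?_
  rw [Metric.mem_ball, Real.dist_eq]
  have ht' : |(α:ℝ)^2 * (s+t) + (β:ℝ)^2 * t - (p:ℝ)^2| < ω := ht
  have e : t - ((p:ℝ)^2 - (α:ℝ)^2 * s) / ((α:ℝ)^2 + (β:ℝ)^2) =
      ((α:ℝ)^2 * (s+t) + (β:ℝ)^2 * t - (p:ℝ)^2) / ((α:ℝ)^2 + (β:ℝ)^2) := by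
    field_simp; ring
  rw [e, abs_div, abs_of_pos hA0]
  calc _ < ω / ((α:ℝ)^2 + (β:ℝ)^2) := by gcongr
    _ ≤ _ := by gcongr

def Eset (s ω : ℝ) (h : ℕ) : Set ℝ := {t | t ∈ Ioo (0:ℝ) (1/2) ∧ ∃ q, ht q = h ∧ |lf s t q| < ω}

lemma volume_Eset_le {s ω : ℝ} (hs : s ∈ Ioo (0:ℝ) (1/2)) {h : ℕ} (hω : 0 ≤ ω) (hω1 : ω ≤ 1)
    (hh : 1 ≤ h) : volume (Eset s ω h) ≤ ENNReal.ofReal (16 * ω) := by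
  have hsub : Eset s ω h ⊆ ⋃ b ∈ Finset.range (h+1), ⋃ p ∈ Finset.range (2*h),
      (Tset s ω h b p ∪ Tset s ω b h p) := by
    rintro t ⟨ht1, q, hq1, hq2⟩
    have hb := lf_sq_bound hs ht1 hω1 hq2
    rw [hq1] at hb
    have hh' : (1:ℝ) ≤ h := by exact_mod_cast hh
    have hp : q.2.natAbs < 2 * h := by
      have : ((q.2.natAbs : ℕ) : ℝ) < 2 * h := by
        refine lt_of_pow_lt_pow_left₀ 2 (by positivity) ?_
        rw [Nat.cast_natAbs, Int.cast_abs, sq_abs]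
        nlinarith
      exact_mod_cast this
    have e : ∀ z : ℤ, ((z.natAbs : ℕ):ℝ)^2 = (z:ℝ)^2 := fun z => by
      rw [Nat.cast_natAbs, Int.cast_abs, sq_abs]
    have hT : t ∈ Tset s ω (q.1 0).natAbs (q.1 1).natAbs q.2.natAbs := by
      simp only [Tset, Set.mem_ofPred_eq, e]
      exact hq2
    simp only [Set.mem_iUnion, Finset.mem_range]
    unfold ht at hq1
    rcases le_total (q.1 0).natAbs (q.1 1).natAbs with hle | hle
    · rw [max_eq_right hle] at hq1
      refine ⟨(q.1 0).natAbs, by omega, q.2.natAbs, hp, Or.inr ?_⟩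
      rwa [← hq1]
    · rw [max_eq_left hle] at hq1
      refine ⟨(q.1 1).natAbs, by omega, q.2.natAbs, hp, Or.inl ?_⟩
      rwa [← hq1]
  have hh' : (1:ℝ) ≤ h := by exact_mod_cast hh
  calc volume (Eset s ω h) ≤ _ := measure_mono hsub
    _ ≤ ∑ b ∈ Finset.range (h+1), volume (⋃ p ∈ Finset.range (2*h),
      (Tset s ω h b p ∪ Tset s ω b h p)) := measure_biUnion_finset_le _ _
    _ ≤ ∑ b ∈ Finset.range (h+1), ∑ p ∈ Finset.range (2*h), ENNReal.ofReal (4 * (ω / (h:ℝ)^2)) := by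
      refine Finset.sum_le_sum fun b _ => (measure_biUnion_finset_le _ _).trans ?_
      refine Finset.sum_le_sum fun p _ => (measure_union_le _ _).trans ?_
      refine (add_le_add (volume_Tset_le hω hh (Or.inl le_rfl))
        (volume_Tset_le hω hh (Or.inr le_rfl))).trans (le_of_eq ?_)
      rw [← ENNReal.ofReal_add (by positivity) (by positivity)]
      congr 1; ring
    _ = ENNReal.ofReal (((h:ℝ)+1) * (2*h) * (4 * (ω / (h:ℝ)^2))) := by
      rw [Finset.sum_const, Finset.sum_const, Finset.card_range, Finset.card_range, smul_smul,
        nsmul_eq_mul, ← ENNReal.ofReal_natCast, ← ENNReal.ofReal_mul (by positivity)]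
      push_cast; rfl
    _ ≤ _ := by
      apply ENNReal.ofReal_le_ofReal
      have : ((h:ℝ)+1) * (2*h) * (4 * (ω / (h:ℝ)^2)) = 8 * ω * ((h+1)/h) := by
        field_simp; ring
      rw [this]
      have h2 : ((h:ℝ)+1)/h ≤ 2 := by rw [div_le_iff₀ (by linarith)]; linarith
      nlinarith

lemma slice_full {w B : ℕ → ℝ} (B0 : ∀ h, 0 ≤ B h) (B1 : ∀ h, B h ≤ 1)
    (hbad : Summable (fun h : ℕ => if B h ≤ (h:ℝ)^2 * w h then 0 else B h))
    {s : ℝ} (hs : s ∈ Ioo (0:ℝ) (1/2))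
    (hfull : ∀ᵐ t : ℝ, !₂[s+t, t] ∉ box2 \ S2 (fun x => B ⌊x⌋₊)) :
    ∀ᵐ t : ℝ, t ∈ Ioo (0:ℝ) (1/2) → ∀ n : ℕ, ∃ q, n ≤ ht q ∧ 1 ≤ ht q ∧
      |lf s t q| < (ht q : ℝ)^2 * w (ht q) := by
  classical
  set E : ℕ → Set ℝ := fun h => if 1 ≤ h ∧ ¬ (B h ≤ (h:ℝ)^2 * w h) then Eset s (B h) h else ∅ with hE
  have hEs : ∑' h, volume (E h) ≠ ⊤ := by
    have hs16 := hbad.mul_left 16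
    have hn : ∀ h : ℕ, 0 ≤ 16 * (if B h ≤ (h:ℝ)^2 * w h then 0 else B h) := by
      intro h; split_ifs
      · simp
      · have := B0 h; positivity
    refine ne_top_of_le_ne_top (hs16.tsum_ofReal_ne_top) (ENNReal.tsum_le_tsum fun h => ?_)
    simp only [hE]
    split_ifs with h1 h2
    · exact absurd h2 h1.2
    · exact volume_Eset_le hs (B0 h) (B1 h) h1.1
    · simp
    · simp
  have hBC := ae_finite_setOfPred_mem hEs
  filter_upwards [hfull, hBC] with t h1 h2 ht' n
  have hbox : (!₂[s+t, t] : EuclideanSpace ℝ (Fin 2)) ∈ box2 := by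
    intro i
    obtain ⟨hs0, hs1⟩ := hs
    obtain ⟨ht0, ht1⟩ := ht'
    fin_cases i <;> simp <;> constructor <;> linarith
  have hS : (!₂[s+t, t] : EuclideanSpace ℝ (Fin 2)) ∈ S2 (fun x => B ⌊x⌋₊) := by
    by_contra hc
    exact h1 ⟨hbox, hc⟩
  have hinf := hS.2
  obtain ⟨N0, hN0⟩ := h2.bddAbove
  set N := max (max n N0) 0 + 1
  have hfin : {q : (Fin 2 → ℤ) × ℤ | ht q ≤ N ∧ |lf s t q| < 1}.Finite := by
    refine ((Set.finite_Icc (fun _ : Fin 2 => -(N:ℤ)) (fun _ => (N:ℤ))).prod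
      (Set.finite_Icc (-(2*N+2:ℤ)) (2*N+2))).subset ?_
    rintro q ⟨hq1, hq2⟩
    have hb := lf_sq_bound hs ht' le_rfl hq2
    have hp : |(q.2:ℝ)| ≤ 2 * N + 2 := by
      refine le_of_lt (lt_of_pow_lt_pow_left₀ 2 (by positivity) ?_)
      rw [sq_abs]
      have : (ht q : ℝ) ≤ N := by exact_mod_cast hq1
      have h0 : (0:ℝ) ≤ ht q := by positivity
      nlinarith
    have hp2 : |q.2| ≤ 2 * N + 2 := by exact_mod_cast hp
    have e0 : (q.1 0).natAbs ≤ N := (le_max_left _ _).trans hq1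
    have e1 : (q.1 1).natAbs ≤ N := (le_max_right _ _).trans hq1
    refine Set.mem_prod.2 ⟨⟨fun i => ?_, fun i => ?_⟩, abs_le.1 hp2⟩
    · fin_cases i <;> simp <;> omega
    · fin_cases i <;> simp <;> omega
  obtain ⟨q, hq1, hq2⟩ := hinf.exists_notMem_finite hfin
  simp only [Set.mem_ofPred_eq, Nat.floor_natCast] at hq1 hq2
  have hq1' : |lf s t q| < B (ht q) := by simpa [lf, ht] using hq1
  have hN : N < ht q := by
    by_contra hc
    exact hq2 ⟨not_lt.1 hc, hq1'.trans_le (B1 _)⟩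
  have hnN : n ≤ N := by omega
  have hN0N : N0 ≤ N := by omega
  refine ⟨q, by omega, by omega, ?_⟩
  by_cases hg : B (ht q) ≤ (ht q : ℝ)^2 * w (ht q)
  · exact hq1'.trans_le hg
  · exfalso
    have : ht q ∈ {h | t ∈ E h} := by
      simp only [Set.mem_ofPred_eq, hE]
      rw [if_pos ⟨by omega, hg⟩]
      exact ⟨ht', q, rfl, hq1'⟩
    have := hN0 this
    omega

/-! ### The unbounded case -/

lemma ht_sq_le (q : (Fin 2 → ℤ) × ℤ) : (ht q : ℝ)^2 ≤ (q.1 0 : ℝ)^2 + (q.1 1 : ℝ)^2 ∧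
    (q.1 0 : ℝ)^2 + (q.1 1 : ℝ)^2 ≤ 2 * (ht q : ℝ)^2 := by
  have e : ∀ z : ℤ, ((z.natAbs : ℕ):ℝ)^2 = (z:ℝ)^2 := fun z => by
    rw [Nat.cast_natAbs, Int.cast_abs, sq_abs]
  rw [← e, ← e]
  unfold ht
  set a : ℕ := (q.1 0).natAbs
  set b : ℕ := (q.1 1).natAbs
  have ha : (0:ℝ) ≤ a := by positivity
  have hb : (0:ℝ) ≤ b := by positivity
  rcases le_total a b with h | h
  · rw [max_eq_right h]
    have : (a:ℝ) ≤ b := by exact_mod_cast h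
    constructor <;> nlinarith
  · rw [max_eq_left h]
    have : (b:ℝ) ≤ a := by exact_mod_cast h
    constructor <;> nlinarith

theorem unbounded_case {ψ : ℝ → ℝ} (hψ0 : ∀ h, 0 ≤ ψ h) (hanti : AntitoneOn ψ (Set.Ici 0))
    (hlim : Tendsto ψ atTop (nhds 0))
    (bdkl : ∀ ψ' : ℝ → ℝ, (∀ h, 0 ≤ ψ' h) →
      (MonotoneOn ψ' (Set.Ici 0) ∨ AntitoneOn ψ' (Set.Ici 0)) →
      Tendsto ψ' atTop (nhds 0) →
      (∑' h : ℕ, ENNReal.ofReal (ψ' ((h : ℝ) + 1)) = ⊤) →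
      volume (box2 \ S2 ψ') = 0)
    {f g : ℝ → ℝ} {r0 : ℝ} (G : Gauge g r0) (fg : ∀ r, 0 ≤ r → f r = r * g r)
    (hdiv : ∑' h : ℕ,
      ENNReal.ofReal (g (ψ ((h : ℝ) + 1) / ((h : ℝ) + 1) ^ 2) * ((h : ℝ) + 1) ^ 2) = ⊤) :
    hMeasure f (S2 ψ) = ⊤ := by
  have g0 : ∀ r, 0 ≤ r → 0 ≤ g r := fun r hr => by
    have := G.mono 0 r le_rfl hr
    rwa [G.zero] at this
  set w : ℕ → ℝ := fun h => g (ψ h / (2 * (h:ℝ)^2)) with hw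
  have harg : ∀ h : ℕ, 0 ≤ ψ h / (2 * (h:ℝ)^2) := fun h => div_nonneg (hψ0 _) (by positivity)
  have w0 : ∀ h, 0 ≤ w h := fun h => g0 _ (harg h)
  have wanti : ∀ h k, 1 ≤ h → h ≤ k → w k ≤ w h := by
    intro h k hh hk
    refine G.mono _ _ (harg k) ?_
    have h1 : (1:ℝ) ≤ h := by exact_mod_cast hh
    have h2 : (h:ℝ) ≤ k := by exact_mod_cast hk
    have h3 : ψ k ≤ ψ h := hanti (by simp) (by simp) h2
    exact div_le_div₀ (hψ0 _) h3 (by positivity) (by gcongr)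
  have wdiv : ¬ Summable (fun h : ℕ => (h:ℝ)^2 * w h) := by
    intro hs
    have hs2 := ((summable_nat_add_iff 1).2 hs).mul_left 2
    apply hs2.tsum_ofReal_ne_top
    rw [eq_top_iff, ← hdiv]
    refine ENNReal.tsum_le_tsum fun h => ENNReal.ofReal_le_ofReal ?_
    simp only [hw]
    push_cast
    have hp : (0:ℝ) < (h:ℝ)+1 := by positivity
    set u := ψ ((h:ℝ)+1) / ((h:ℝ)+1)^2 with hu
    have hu2 : ψ ((h:ℝ)+1) / (2 * ((h:ℝ)+1)^2) = u / 2 := by rw [hu]; field_simp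
    rw [hu2]
    have hu0 : 0 ≤ u := div_nonneg (hψ0 _) (by positivity)
    have key : g u ≤ 2 * g (u/2) := by
      rcases hu0.eq_or_lt with h' | h'
      · rw [← h']; simp [G.zero]
      · have := G.anti (u/2) u (by linarith) (by linarith)
        nlinarith
    nlinarith [sq_nonneg ((h:ℝ)+1), mul_le_mul_of_nonneg_right key (sq_nonneg ((h:ℝ)+1))]
  obtain ⟨B, B0, B1, Banti, Blim, Bdiv, Bbad⟩ := theta_exists w w0 wanti wdiv
  have hvol := bdkl (fun x => B ⌊x⌋₊) (fun h => B0 _)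
    (Or.inr fun x _ y _ hxy => Banti (Nat.floor_mono hxy))
    (Blim.comp tendsto_nat_floor_atTop) (by
      by_contra hne
      apply Bdiv
      rw [← summable_nat_add_iff 1]
      have e : ∀ h : ℕ, ⌊(h:ℝ)+1⌋₊ = h + 1 := fun h => by
        have := Nat.floor_natCast (R := ℝ) (h+1)
        push_cast at this
        exact this
      simp only [e] at hne
      have := ENNReal.summable_toReal hne
      refine this.congr fun h => ?_
      rw [ENNReal.toReal_ofReal (B0 _)])
  by_contra hA
  have hsl := slicing fg G.zero g0 G.mono _ hA
  have hae := ae_slices hvol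
  have hex : ∃ s ∈ Ioo (0:ℝ) (1/2), hMeasure g {t : ℝ | !₂[s+t, t] ∈ S2 ψ} ≠ ⊤ ∧
      ∀ᵐ t : ℝ, !₂[s+t, t] ∉ box2 \ S2 (fun x => B ⌊x⌋₊) := by
    by_contra hc
    have hz : volume (Ioo (0:ℝ) (1/2)) = 0 := by
      refine measure_eq_zero_iff_ae_notMem.2 ?_
      filter_upwards [hsl, hae] with s h1 h2 hs
      exact hc ⟨s, hs, h1, h2⟩
    rw [Real.volume_Ioo] at hz
    norm_num at hz
  obtain ⟨s, hs, hs1, hs2⟩ := hex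
  apply hs1
  have hfull := slice_full B0 B1 Bbad hs hs2
  set x : (Fin 2 → ℤ) × ℤ → ℝ := fun q =>
    ((q.2:ℝ)^2 - (q.1 0:ℝ)^2 * s) / ((q.1 0:ℝ)^2 + (q.1 1:ℝ)^2) with hx
  set r : (Fin 2 → ℤ) × ℤ → ℝ := fun q => ψ (ht q) / ((q.1 0:ℝ)^2 + (q.1 1:ℝ)^2) with hr
  have hdist : ∀ q, 1 ≤ ht q → ∀ t, |t - x q| = |lf s t q| / ((q.1 0:ℝ)^2 + (q.1 1:ℝ)^2) := by
    intro q hq t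
    have h1 : (1:ℝ) ≤ ht q := by exact_mod_cast hq
    have h2 := (ht_sq_le q).1
    have hA0 : 0 < (q.1 0:ℝ)^2 + (q.1 1:ℝ)^2 := by nlinarith
    rw [← abs_of_pos hA0, ← abs_div]
    congr 1
    simp only [hx, lf]
    field_simp; ring
  have S : Sys g x r ht (Ioo (0:ℝ) (1/2)) := by
    refine ⟨fun q => div_nonneg (hψ0 _) (by positivity), fun ε hε => ?_, fun n => ?_⟩
    · obtain ⟨N, hN⟩ := eventually_atTop.1 (hlim.eventually_le_const hε)
      refine ⟨⌈N⌉₊ + 1, fun q hq => ?_⟩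
      have h1 : (1:ℝ) ≤ ht q := by exact_mod_cast (by omega : 1 ≤ ht q)
      have h2 := (ht_sq_le q).1
      have h3 : N ≤ ht q := (Nat.le_ceil N).trans (by exact_mod_cast (by omega : ⌈N⌉₊ ≤ ht q))
      exact (div_le_self (hψ0 _) (by nlinarith)).trans (hN _ h3)
    · filter_upwards [hfull] with t ht1 ht2
      obtain ⟨q, hq1, hq2, hq3⟩ := ht1 ht2 n
      refine ⟨q, hq1, ?_⟩
      rw [hdist q hq2]
      have h1 : (1:ℝ) ≤ ht q := by exact_mod_cast hq2
      obtain ⟨h2, h3⟩ := ht_sq_le q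
      have hA0 : 0 < (q.1 0:ℝ)^2 + (q.1 1:ℝ)^2 := by nlinarith
      rw [div_lt_iff₀ hA0]
      have h4 : w (ht q) ≤ g (r q) := by
        refine G.mono _ _ (harg _) ?_
        exact div_le_div_of_nonneg_left (hψ0 _) hA0 h3
      calc |lf s t q| < (ht q:ℝ)^2 * w (ht q) := hq3
        _ ≤ ((q.1 0:ℝ)^2 + (q.1 1:ℝ)^2) * g (r q) := by
          have := w0 (ht q)
          gcongr
        _ = _ := mul_comm _ _
  have hm := mtp_one G (Metric.isBounded_Ioo _ _) isOpen_Ioo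
    (by rw [Real.volume_Ioo]; norm_num) S
  rw [eq_top_iff, ← hm]
  refine measure_mono fun t ht' => ?_
  obtain ⟨htI, htT⟩ := ht'
  refine ⟨fun i => ?_, ?_⟩
  · obtain ⟨hs0, hs1⟩ := hs
    obtain ⟨ht0, ht1⟩ := htI
    fin_cases i <;> simp <;> constructor <;> linarith
  · refine Set.Infinite.of_image ht (Set.infinite_of_not_bddAbove ?_)
    rintro ⟨N, hN⟩
    have := Set.mem_iInter.1 htT (N+1)
    obtain ⟨q, hq1, hq2⟩ := this
    have h1 : (1:ℝ) ≤ ht q := by exact_mod_cast (by omega : 1 ≤ ht q)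
    have h2 := (ht_sq_le q).1
    have hA0 : 0 < (q.1 0:ℝ)^2 + (q.1 1:ℝ)^2 := by nlinarith
    rw [hdist q (by omega)] at hq2
    simp only [hr] at hq2
    rw [div_lt_div_iff_of_pos_right hA0] at hq2
    have hmem : ht q ∈ Set.image ht {q : (Fin 2 → ℤ) × ℤ |
      |(q.1 0 : ℝ) ^ 2 * (!₂[s+t, t] : EuclideanSpace ℝ (Fin 2)) 0 + (q.1 1 : ℝ) ^ 2 *
        (!₂[s+t, t] : EuclideanSpace ℝ (Fin 2)) 1 - (q.2 : ℝ) ^ 2| <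
        ψ ((max (q.1 0).natAbs (q.1 1).natAbs : ℕ) : ℝ)} := by
      refine ⟨q, ?_, rfl⟩
      have : |lf s t q| < ψ ((max (q.1 0).natAbs (q.1 1).natAbs : ℕ) : ℝ) := hq2
      exact this
    have := hN hmem
    omega

/-! ### The bounded case -/

theorem bounded_case {ψ : ℝ → ℝ} (hψ0 : ∀ h, 0 ≤ ψ h) (hanti : AntitoneOn ψ (Set.Ici 0))
    (hlim : Tendsto ψ atTop (nhds 0))
    (bdkl : ∀ ψ' : ℝ → ℝ, (∀ h, 0 ≤ ψ' h) →
      (MonotoneOn ψ' (Set.Ici 0) ∨ AntitoneOn ψ' (Set.Ici 0)) →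
      Tendsto ψ' atTop (nhds 0) →
      (∑' h : ℕ, ENNReal.ofReal (ψ' ((h : ℝ) + 1)) = ⊤) →
      volume (box2 \ S2 ψ') = 0)
    {f g : ℝ → ℝ} (gz : g 0 = 0) (fg : ∀ r, 0 ≤ r → f r = r * g r)
    {C δ : ℝ} (hC : 0 < C) (hδ : 0 < δ) (hb : ∀ r, 0 < r → r < δ → f r ≤ C * r^2)
    (hdiv : ∑' h : ℕ,
      ENNReal.ofReal (g (ψ ((h : ℝ) + 1) / ((h : ℝ) + 1) ^ 2) * ((h : ℝ) + 1) ^ 2) = ⊤) :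
    hMeasure f (S2 ψ) = hMeasure f box2 := by
  have hgb : ∀ r, 0 ≤ r → r < δ → g r ≤ C * r := by
    intro r hr hrd
    rcases hr.eq_or_lt with h | h
    · rw [← h]; simp [gz]
    · have := hb r h hrd
      rw [fg r hr] at this
      exact le_of_mul_le_mul_left (by nlinarith) h
  have hfb : ∀ r, 0 ≤ r → r < δ → f r ≤ C * r^2 := by
    intro r hr hrd
    rw [fg r hr]
    nlinarith [hgb r hr hrd]
  have hsum : ∑' h : ℕ, ENNReal.ofReal (ψ ((h : ℝ) + 1)) = ⊤ := by
    by_contra hne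
    have hs := ENNReal.summable_toReal hne
    have hs' : Summable (fun h : ℕ => ψ ((h:ℝ)+1)) :=
      hs.congr fun h => by rw [ENNReal.toReal_ofReal (hψ0 _)]
    obtain ⟨N, hN⟩ := eventually_atTop.1 (hlim.eventually_lt_const hδ)
    have hle : ∀ h : ℕ, ⌈N⌉₊ ≤ h →
        g (ψ ((h : ℝ) + 1) / ((h : ℝ) + 1) ^ 2) * ((h : ℝ) + 1) ^ 2 ≤ C * ψ ((h:ℝ)+1) := by
      intro h hh
      have h1 : N ≤ (h:ℝ) + 1 := by
        have : (⌈N⌉₊:ℝ) ≤ h := by exact_mod_cast hh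
        linarith [Nat.le_ceil N]
      have hp : (1:ℝ) ≤ ((h:ℝ)+1)^2 := one_le_pow₀ (by linarith [(Nat.cast_nonneg h : (0:ℝ) ≤ h)])
      have h2 := hgb (ψ ((h : ℝ) + 1) / ((h : ℝ) + 1) ^ 2) (div_nonneg (hψ0 _) (by positivity))
        ((div_le_self (hψ0 _) hp).trans_lt (hN _ h1))
      calc _ ≤ C * (ψ ((h : ℝ) + 1) / ((h : ℝ) + 1) ^ 2) * ((h : ℝ) + 1) ^ 2 := by gcongr
        _ = _ := by field_simp
    rw [← Summable.sum_add_tsum_nat_add' (f := fun h : ℕ => ENNReal.ofReal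
      (g (ψ ((h : ℝ) + 1) / ((h : ℝ) + 1) ^ 2) * ((h : ℝ) + 1) ^ 2)) (k := ⌈N⌉₊) ENNReal.summable] at hdiv
    rw [ENNReal.add_eq_top] at hdiv
    rcases hdiv with hdiv | hdiv
    · exact (ENNReal.sum_ne_top.2 fun _ _ => ENNReal.ofReal_ne_top) hdiv
    · have hs3 := ((summable_nat_add_iff ⌈N⌉₊).2 hs').mul_left C
      apply hs3.tsum_ofReal_ne_top
      rw [eq_top_iff, ← hdiv]
      refine ENNReal.tsum_le_tsum fun h => ENNReal.ofReal_le_ofReal ?_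
      exact hle _ (by omega)
  have hvol := bdkl ψ hψ0 (Or.inr hanti) hlim hsum
  have hle : (hMeasure f : Measure (EuclideanSpace ℝ (Fin 2))) ≤
      ENNReal.ofReal C • Measure.hausdorffMeasure 2 := by
    refine Measure.mkMetric_mono_smul ENNReal.ofReal_ne_top (by simpa using hC) ?_
    have hmem : Set.Iio (ENNReal.ofReal δ) ∈ nhds (0:ℝ≥0∞) := Iio_mem_nhds (by simpa using hδ)
    filter_upwards [mem_nhdsWithin_of_mem_nhds hmem] with d hd
    have hdt : d ≠ ⊤ := (lt_top_of_lt hd).ne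
    have hdr : d.toReal < δ := by
      have := (ENNReal.toReal_lt_toReal hdt ENNReal.ofReal_ne_top).2 hd
      rwa [ENNReal.toReal_ofReal hδ.le] at this
    simp only [Pi.smul_apply, smul_eq_mul]
    calc ENNReal.ofReal (f d.toReal) ≤ ENNReal.ofReal (C * d.toReal^2) :=
          ENNReal.ofReal_le_ofReal (hfb _ ENNReal.toReal_nonneg hdr)
      _ = ENNReal.ofReal C * d ^ (2:ℝ) := by
        rw [ENNReal.ofReal_mul hC.le, ENNReal.ofReal_pow ENNReal.toReal_nonneg,
          ENNReal.ofReal_toReal hdt]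
        norm_cast
  have hH : (Measure.hausdorffMeasure 2 : Measure (EuclideanSpace ℝ (Fin 2))) ≪ volume := by
    have hfr : ((Module.finrank ℝ (EuclideanSpace ℝ (Fin 2)) : ℕ) : ℝ) = 2 := by simp
    have hi : (Measure.hausdorffMeasure 2 : Measure (EuclideanSpace ℝ (Fin 2))).IsAddHaarMeasure := by
      rw [← hfr]; infer_instance
    exact Measure.absolutelyContinuous_isAddHaarMeasure _ _
  have hz : hMeasure f (box2 \ S2 ψ) = 0 := by
    have := hle (box2 \ S2 ψ)
    rw [Measure.smul_apply, hH hvol] at this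
    simpa using this
  have hsub : S2 ψ ⊆ box2 := fun x hx => hx.1
  refine le_antisymm (measure_mono hsub) ?_
  calc hMeasure f box2 ≤ hMeasure f (S2 ψ ∪ box2 \ S2 ψ) := measure_mono (by
        intro x hx
        by_cases h : x ∈ S2 ψ
        · exact Or.inl h
        · exact Or.inr ⟨hx, h⟩)
    _ ≤ hMeasure f (S2 ψ) + hMeasure f (box2 \ S2 ψ) := measure_union_le _ _
    _ = _ := by rw [hz, add_zero]
theorem stmt16 (ψ : ℝ → ℝ) (hψ0 : ∀ h, 0 ≤ ψ h)
    (hmono : MonotoneOn ψ (Set.Ici 0) ∨ AntitoneOn ψ (Set.Ici 0))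
    (hlim : Tendsto ψ atTop (nhds 0))
    -- Theorem BDKL (divergent part), taken as a hypothesis:
    (bdkl : ∀ ψ' : ℝ → ℝ, (∀ h, 0 ≤ ψ' h) →
      (MonotoneOn ψ' (Set.Ici 0) ∨ AntitoneOn ψ' (Set.Ici 0)) →
      Tendsto ψ' atTop (nhds 0) →
      (∑' h : ℕ, ENNReal.ofReal (ψ' ((h : ℝ) + 1)) = ⊤) →
      volume (box2 \ S2 ψ') = 0)
    (f g : ℝ → ℝ) (hf : IsDimFun f) (hg : IsDimFun g)
    (hmonof : MonotoneOn (fun r => f r / r ^ 2) (Set.Ioi 0) ∨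
      AntitoneOn (fun r => f r / r ^ 2) (Set.Ioi 0))
    (hgdef : ∀ r > (0:ℝ), g r = f r / r)
    (hdiv : ∑' h : ℕ,
      ENNReal.ofReal (g (ψ ((h : ℝ) + 1) / ((h : ℝ) + 1) ^ 2) * ((h : ℝ) + 1) ^ 2) = ⊤) :
    hMeasure f (S2 ψ) = hMeasure f box2 := by
  have hanti : AntitoneOn ψ (Set.Ici 0) := by
    rcases hmono with h | h
    · have hz : ∀ x ∈ Set.Ici (0:ℝ), ψ x = 0 := by
        intro x hx
        refine le_antisymm ?_ (hψ0 x)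
        refine ge_of_tendsto hlim ?_
        filter_upwards [eventually_ge_atTop x] with y hy
        exact h hx (le_trans hx hy) hy
      intro x hx y hy _
      rw [hz x hx, hz y hy]
    · exact h
  have zero_of : ∀ k : ℝ → ℝ, IsDimFun k → k 0 = 0 := by
    intro k hk
    have h1 : Tendsto k (nhdsWithin 0 (Set.Ioi 0)) (nhds (k 0)) :=
      (hk.1 0 (by simp)).mono_left (nhdsWithin_mono _ Set.Ioi_subset_Ici_self)
    exact tendsto_nhds_unique h1 hk.2.2.2
  have fz := zero_of f hf
  have gz := zero_of g hg
  have fg : ∀ r, 0 ≤ r → f r = r * g r := by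
    intro r hr
    rcases hr.eq_or_lt with h | h
    · rw [← h]; simp [fz]
    · rw [hgdef r h]; field_simp
  by_cases hbd : ∃ C δ : ℝ, 0 < C ∧ 0 < δ ∧ ∀ r, 0 < r → r < δ → f r ≤ C * r^2
  · obtain ⟨C, δ, hC, hδ, hb⟩ := hbd
    exact bounded_case hψ0 hanti hlim bdkl gz fg hC hδ hb hdiv
  · push Not at hbd
    have hfanti : AntitoneOn (fun r => f r / r ^ 2) (Set.Ioi 0) := by
      rcases hmonof with h | h
      · exfalso
        have hf1 : 0 ≤ f 1 := hf.2.2.1 1 zero_le_one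
        obtain ⟨r, hr0, hr1, hr2⟩ := hbd (f 1 + 1) 1 (by linarith) one_pos
        have := h (Set.mem_Ioi.2 hr0) (Set.mem_Ioi.2 one_pos) hr1.le
        simp only [one_pow, div_one] at this
        rw [div_le_iff₀ (by positivity)] at this
        nlinarith [sq_nonneg r]
      · exact h
    have big : ∀ M : ℝ, ∃ δ > 0, ∀ r, 0 < r → r ≤ δ → M * r ≤ g r := by
      intro M
      obtain ⟨r1, h0, _, h2⟩ := hbd (max M 1) 1 (by positivity) one_pos
      refine ⟨r1, h0, fun r hr hr1 => ?_⟩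
      have h3 := hfanti (Set.mem_Ioi.2 hr) (Set.mem_Ioi.2 h0) hr1
      simp only at h3
      have h4 : M ≤ f r1 / r1^2 := by
        rw [le_div_iff₀ (by positivity)]
        nlinarith [le_max_left M 1, sq_nonneg r1, mul_le_mul_of_nonneg_right (le_max_left M 1) (sq_nonneg r1)]
      have h5 := h4.trans h3
      rw [le_div_iff₀ (by positivity), fg r hr.le] at h5
      exact le_of_mul_le_mul_left (by nlinarith) hr
    obtain ⟨r0, hr0, hself⟩ := big 1
    have G : Gauge g r0 := by
      refine ⟨hr0, gz, hg.1, fun r s hr hrs => hg.2.1 hr (le_trans hr hrs) hrs,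
        fun r s hr hrs => ?_, big, fun r hr hrr => by simpa using hself r hr hrr, fun ε hε => ?_⟩
      · have hs : 0 < s := hr.trans_le hrs
        have h3 := hfanti (Set.mem_Ioi.2 hr) (Set.mem_Ioi.2 hs) hrs
        simp only at h3
        rw [fg r hr.le, fg s hs.le, show s * g s / s^2 = g s / s by field_simp,
          show r * g r / r^2 = g r / r by field_simp, div_le_div_iff₀ hs hr] at h3
        exact h3
      · have h1 : Tendsto g (nhdsWithin 0 (Set.Ici 0)) (nhds 0) := by
          have := hg.1 0 (by simp)
          rwa [ContinuousWithinAt, gz] at this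
        have h2 := h1.eventually_le_const hε
        rw [eventually_nhdsWithin_iff, Metric.eventually_nhds_iff] at h2
        obtain ⟨δ, hδ, h3⟩ := h2
        refine ⟨δ/2, by linarith, fun r hr hrd => h3 ?_ hr⟩
        rw [Real.dist_eq, sub_zero, abs_of_nonneg hr]; linarith
    have ht := unbounded_case hψ0 hanti hlim bdkl G fg hdiv
    rw [ht]
    have hsub : S2 ψ ⊆ box2 := fun x hx => hx.1
    have := measure_mono (μ := hMeasure f) hsub
    rw [ht] at this
    exact (top_le_iff.1 this).symm
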